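/- arXiv:2108.13678 — 4 statements merged into one kernel-verified Lean document; each statement's English description precedes it below -/
import Mathlib

section
/- For n×n complex Hermitian matrices A₁, …, A_{n-2}, A, B with A₁, …, A_{n-2}, A positive semidefinite, the mixed discriminant satisfies D(A₁,…,A_{n-2},A,B)² ≥ D(A₁,…,A_{n-2},A,A) · D(A₁,…,A_{n-2},B,B). -/
open scoped ComplexOrder

/-- The mixed discriminant of `m` Hermitian `m × m` complex matrices: the full
polarization of the determinant, `D(A, …, A) = det A`. -/
noncomputable def mixedDisc {m : ℕ} (A : Fin m → Matrix (Fin m) (Fin m) ℂ) : ℝ :=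
  ((m.factorial : ℂ)⁻¹ *
    ∑ σ : Equiv.Perm (Fin m), (Matrix.of fun i j => A (σ j) i j).det).re

/-- `D(A₁, …, Aₙ, X, Y)` for a family of `n` matrices of size `n + 2` together
with two extra entries `X`, `Y`. -/
noncomputable def mixedDisc2 {n : ℕ} (A : Fin n → Matrix (Fin (n + 2)) (Fin (n + 2)) ℂ)
    (X Y : Matrix (Fin (n + 2)) (Fin (n + 2)) ℂ) : ℝ :=
  mixedDisc (Fin.snoc (Fin.snoc A X) Y)

open Polynomial in
lemma deriv_ne_zero_of_upper (p : ℂ[X]) (hd : 0 < p.degree)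
    (hp : ∀ t : ℂ, 0 ≤ t.im → p.eval t ≠ 0) : p.coeff 1 ≠ 0 := by
  intro h0
  have hp0 : p ≠ 0 := by rintro rfl; simp at hd
  have hd' : p.derivative ≠ 0 := by
    intro h
    have := derivative_eq_zero.mp h
    rw [← natDegree_pos_iff_degree_pos] at hd
    omega
  have hr : (0 : ℂ) ∈ p.derivative.rootSet ℂ := by
    rw [mem_rootSet]
    refine ⟨hd', ?_⟩
    rw [coe_aeval_eq_eval, ← coeff_zero_eq_eval_zero, coeff_derivative]
    simp [h0]
  have h1 := rootSet_derivative_subset_convexHull_rootSet hd hr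
  have hsub : p.rootSet ℂ ⊆ {z : ℂ | z.im < 0} := by
    intro z hz
    rw [mem_rootSet] at hz
    by_contra hcon
    exact hp z (not_lt.mp hcon) (by simpa [coe_aeval_eq_eval] using hz.2)
  have := convexHull_min hsub (convex_halfSpace_im_lt 0) h1
  simp at this

open Polynomial in
lemma mixed_step {ι V : Type*} [Fintype ι] [DecidableEq ι] [AddCommGroup V] [Module ℂ V]
    (F : MultilinearMap ℂ (fun _ : ι => V) ℂ)
    (hF : ∀ (τ : Equiv.Perm ι) (v : ι → V), F (fun i => v (τ i)) = F v)
    (H : Set V) (A : ι → V) (S : Finset ι) (a : ι) (ha : a ∉ S)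
    (hI : Complex.I • A a ∈ H)
    (hadd : ∀ Z ∈ H, ∀ t : ℂ, 0 ≤ t.im → Z + t • A a ∈ H)
    (ih : ∀ Z ∈ H, F (S.piecewise A fun _ => Z) ≠ 0) (Z : V) (hZ : Z ∈ H) :
    F ((insert a S).piecewise A fun _ => Z) ≠ 0 := by
  set m : ι → V := S.piecewise A fun _ => Z with hm
  set p : ℂ[X] := ∑ s ∈ Sᶜ.powerset, C (F (s.piecewise (fun _ => A a) m)) * X ^ s.card with hpdef
  have heval : ∀ t : ℂ, p.eval t = F (S.piecewise A fun _ => Z + t • A a) := by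
    intro t
    have h1 := F.map_piecewise_add (fun _ => t • A a) m Sᶜ
    have h2 : Sᶜ.piecewise ((fun _ => t • A a) + m) m = S.piecewise A fun _ => Z + t • A a := by
      ext i
      by_cases hi : i ∈ S <;> simp [hm, Finset.piecewise, hi, add_comm]
    rw [h2] at h1
    rw [h1, hpdef, eval_finsetSum]
    refine Finset.sum_congr rfl fun s _ => ?_
    have h3 := F.map_piecewise_smul (fun _ => t) (s.piecewise (fun _ => A a) m) s
    have h4 : s.piecewise (fun i => t • (s.piecewise (fun _ => A a) m) i)
        (s.piecewise (fun _ => A a) m) = s.piecewise (fun _ => t • A a) m := by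
      ext i
      by_cases hi : i ∈ s <;> simp [Finset.piecewise, hi]
    rw [h4] at h3
    rw [h3, eval_mul, eval_C, eval_pow, eval_X, Finset.prod_const, smul_eq_mul, mul_comm]
  have hcoeff : ∀ k, p.coeff k =
      ∑ s ∈ Finset.powersetCard k Sᶜ, F (s.piecewise (fun _ => A a) m) := by
    intro k
    rw [hpdef, finsetSum_coeff, Finset.powersetCard_eq_filter, Finset.sum_filter]
    refine Finset.sum_congr rfl fun s _ => ?_
    simp [coeff_X_pow, eq_comm]
  have hcpos : 0 < Sᶜ.card := Finset.card_pos.mpr ⟨a, by simpa using ha⟩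
  have htop : p.coeff Sᶜ.card ≠ 0 := by
    rw [hcoeff, Finset.powersetCard_self, Finset.sum_singleton]
    have h5 := ih _ hI
    have h6 := F.map_piecewise_smul (fun _ => Complex.I) (Sᶜ.piecewise (fun _ => A a) m) Sᶜ
    have h7 : Sᶜ.piecewise (fun i => Complex.I • (Sᶜ.piecewise (fun _ => A a) m) i)
        (Sᶜ.piecewise (fun _ => A a) m) = S.piecewise A fun _ => Complex.I • A a := by
      ext i
      by_cases hi : i ∈ S <;> simp [hm, Finset.piecewise, hi]
    rw [h7] at h6
    rw [h6] at h5
    exact fun h => h5 (by rw [h, smul_zero])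
  have hdeg : 0 < p.degree := by
    rw [← natDegree_pos_iff_degree_pos]
    exact lt_of_lt_of_le hcpos (le_natDegree_of_ne_zero htop)
  have h1 := deriv_ne_zero_of_upper p hdeg fun t ht => by
    rw [heval]; exact ih _ (hadd Z hZ t ht)
  rw [hcoeff, Finset.powersetCard_one, Finset.sum_map] at h1
  have h8 : ∀ i ∈ Sᶜ, F (Finset.piecewise {i} (fun _ => A a) m)
      = F ((insert a S).piecewise A fun _ => Z) := by
    intro i hi
    rw [← hF (Equiv.swap a i) ((insert a S).piecewise A fun _ => Z)]
    congr 1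
    ext j
    have hi' : i ∉ S := by simpa using hi
    rw [Finset.piecewise_singleton]
    by_cases hji : j = i
    · subst hji; simp [Finset.piecewise]
    · by_cases hja : j = a
      · subst hja
        simp [Function.update_of_ne hji, hm, Finset.piecewise, ha, hi', Ne.symm hji]
      · rw [Equiv.swap_apply_of_ne_of_ne hja hji]
        simp [Function.update_of_ne hji, hm, Finset.piecewise, hja]
  intro h0
  apply h1
  refine Finset.sum_eq_zero fun i hi => ?_
  exact (h8 i hi).trans h0

/-- matrices with positive definite imaginary part -/
def upperH (m : ℕ) : Set (Matrix (Fin m) (Fin m) ℂ) :=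
  {Z | ∃ X Y : Matrix (Fin m) (Fin m) ℂ, X.IsHermitian ∧ Y.PosDef ∧ Z = X + Complex.I • Y}

lemma isHermitian_real_smul {m : ℕ} {X : Matrix (Fin m) (Fin m) ℂ} (hX : X.IsHermitian) (r : ℝ) :
    ((r : ℂ) • X).IsHermitian := by
  unfold Matrix.IsHermitian
  rw [Matrix.conjTranspose_smul, hX.eq]
  simp

lemma posSemidef_real_smul {m : ℕ} {X : Matrix (Fin m) (Fin m) ℂ} (hX : X.PosSemidef) (r : ℝ)
    (hr : 0 ≤ r) : ((r : ℂ) • X).PosSemidef :=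
  hX.smul (by exact_mod_cast hr)

lemma posDef_real_smul {m : ℕ} {X : Matrix (Fin m) (Fin m) ℂ} (hX : X.PosDef) (r : ℝ)
    (hr : 0 < r) : ((r : ℂ) • X).PosDef :=
  hX.smul (by exact_mod_cast hr)

lemma upperH_add {m : ℕ} {B Z : Matrix (Fin m) (Fin m) ℂ} (hB : B.PosDef) (hZ : Z ∈ upperH m)
    (t : ℂ) (ht : 0 ≤ t.im) : Z + t • B ∈ upperH m := by
  obtain ⟨X, Y, hX, hY, rfl⟩ := hZ
  refine ⟨X + (t.re : ℂ) • B, Y + (t.im : ℂ) • B, hX.add (isHermitian_real_smul hB.1 _),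
    hY.add_posSemidef (posSemidef_real_smul hB.posSemidef _ ht), ?_⟩
  conv_lhs => rw [← Complex.re_add_im t]
  module

lemma upperH_mk {m : ℕ} {A B : Matrix (Fin m) (Fin m) ℂ} (hA : A.PosDef) (hB : B.IsHermitian)
    (t : ℂ) (ht : 0 < t.im) : B + t • A ∈ upperH m := by
  refine ⟨B + (t.re : ℂ) • A, (t.im : ℂ) • A, hB.add (isHermitian_real_smul hA.1 _),
    posDef_real_smul hA _ ht, ?_⟩
  conv_lhs => rw [← Complex.re_add_im t]
  module

lemma upperH_det {m : ℕ} {Z : Matrix (Fin m) (Fin m) ℂ} (hZ : Z ∈ upperH m) : Z.det ≠ 0 := by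
  obtain ⟨X, Y, hX, hY, rfl⟩ := hZ
  intro h
  obtain ⟨v, hv, h0⟩ := Matrix.exists_mulVec_eq_zero_iff.mpr h
  have h1 := congrArg (fun w => (star v ⬝ᵥ w).im) h0
  have h2 := hX.im_star_dotProduct_mulVec_self v
  have h3 := hY.dotProduct_mulVec_pos hv
  rw [Complex.lt_def] at h3
  simp only [Matrix.add_mulVec, Matrix.smul_mulVec, dotProduct_add, dotProduct_smul,
    Complex.add_im, dotProduct_zero, smul_eq_mul, Complex.mul_im, Complex.I_re, Complex.I_im,
    Complex.zero_im] at h1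
  simp at h2 h3
  rw [h2] at h1
  linarith [h3.1]

/-- the complex multilinear form -/
noncomputable def mixF (m : ℕ) :
    MultilinearMap ℂ (fun _ : Fin m => Matrix (Fin m) (Fin m) ℂ) ℂ :=
  ∑ σ : Equiv.Perm (Fin m), ∑ τ : Equiv.Perm (Fin m), (Equiv.Perm.sign τ : ℤ) •
    ((MultilinearMap.mkPiAlgebra ℂ (Fin m) ℂ).compLinearMap
      (fun j => Matrix.entryLinearMap ℂ ℂ (τ j) j)).domDomCongr σ

lemma mixF_apply' {m : ℕ} (A : Fin m → Matrix (Fin m) (Fin m) ℂ) :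
    mixF m A = ∑ σ : Equiv.Perm (Fin m), ∑ τ : Equiv.Perm (Fin m), (Equiv.Perm.sign τ : ℤ) •
      ∏ j, A (σ j) (τ j) j := by
  simp [mixF]

lemma mixF_apply {m : ℕ} (A : Fin m → Matrix (Fin m) (Fin m) ℂ) :
    mixF m A = ∑ σ : Equiv.Perm (Fin m), (Matrix.of fun i j => A (σ j) i j).det := by
  rw [mixF_apply']
  refine Finset.sum_congr rfl fun σ _ => ?_
  rw [Matrix.det_apply]
  rfl

lemma mixF_symm {m : ℕ} (τ : Equiv.Perm (Fin m)) (A : Fin m → Matrix (Fin m) (Fin m) ℂ) :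
    mixF m (fun i => A (τ i)) = mixF m A := by
  rw [mixF_apply, mixF_apply]
  exact Fintype.sum_equiv (Equiv.mulLeft τ) _ _ fun σ => rfl

lemma mixF_conj {m : ℕ} (A : Fin m → Matrix (Fin m) (Fin m) ℂ) (hA : ∀ i, (A i).IsHermitian) :
    star (mixF m A) = mixF m A := by
  have h : star (mixF m A) = ∑ τ : Equiv.Perm (Fin m), ∑ σ : Equiv.Perm (Fin m),
      (Equiv.Perm.sign τ : ℤ) • ∏ j, A (σ j) j (τ j) := by
    rw [mixF_apply', Finset.sum_comm, star_sum]
    refine Finset.sum_congr rfl fun τ _ => ?_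
    rw [star_sum]
    refine Finset.sum_congr rfl fun σ _ => ?_
    rw [star_zsmul, star_prod]
    congr 1
    refine Finset.prod_congr rfl fun j _ => ?_
    exact (hA _).apply _ _
  rw [h, mixF_apply']
  refine Eq.trans ?_ Finset.sum_comm
  refine Fintype.sum_equiv (Equiv.inv _) _ _ fun τ => ?_
  refine Fintype.sum_equiv (Equiv.mulRight τ⁻¹) _ _ fun σ => ?_
  simp only [Equiv.inv_apply, Equiv.coe_mulRight]
  rw [Equiv.Perm.sign_inv]
  congr 1
  refine Fintype.prod_equiv τ (fun j => A (σ j) j (τ j))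
    (fun j => A ((σ * τ⁻¹) j) (τ⁻¹ j) j) fun j => ?_
  simp

lemma mixF_diag {m : ℕ} (Z : Matrix (Fin m) (Fin m) ℂ) :
    mixF m (fun _ => Z) = (m.factorial : ℂ) * Z.det := by
  rw [mixF_apply]
  have : (Matrix.of fun i j => Z i j) = Z := rfl
  simp [this, Fintype.card_perm]

lemma mixF_ne {m : ℕ} (A : Fin m → Matrix (Fin m) (Fin m) ℂ) (hA : ∀ i, (A i).PosDef)
    (S : Finset (Fin m)) : ∀ Z ∈ upperH m, mixF m (S.piecewise A fun _ => Z) ≠ 0 := by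
  induction S using Finset.induction_on with
  | empty =>
    intro Z hZ
    rw [Finset.piecewise_empty, mixF_diag]
    exact mul_ne_zero (by exact_mod_cast m.factorial_ne_zero) (upperH_det hZ)
  | insert a S ha ih =>
    refine fun Z hZ => mixed_step _ mixF_symm (upperH m) A S a ha ?_ ?_ ih Z hZ
    · simpa using upperH_mk (hA a) Matrix.isHermitian_zero Complex.I (by simp)
    · exact fun Z hZ t ht => upperH_add (hA a) hZ t ht

lemma mixedDisc_eq {m : ℕ} (A : Fin m → Matrix (Fin m) (Fin m) ℂ) :
    mixedDisc A = (m.factorial : ℝ)⁻¹ * (mixF m A).re := by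
  rw [mixedDisc, mixF_apply]
  have : ((m.factorial : ℂ)⁻¹) = (((m.factorial : ℝ)⁻¹ : ℝ) : ℂ) := by push_cast; rfl
  rw [this, Complex.re_ofReal_mul]

lemma snoc_herm {m k : ℕ} (A : Fin k → Matrix (Fin m) (Fin m) ℂ) (X : Matrix (Fin m) (Fin m) ℂ)
    (P : Matrix (Fin m) (Fin m) ℂ → Prop) (hA : ∀ i, P (A i)) (hX : P X) :
    ∀ i, P ((Fin.snoc A X : Fin (k + 1) → Matrix (Fin m) (Fin m) ℂ) i) := by
  intro i
  refine Fin.lastCases ?_ (fun j => ?_) i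
  · simpa using hX
  · simpa using hA j

lemma real_quad (a b c : ℝ)
    (h : ∀ t : ℂ, 0 < t.im → (a : ℂ) * t ^ 2 + 2 * b * t + c ≠ 0) : a * c ≤ b ^ 2 := by
  by_contra! hlt
  have ha : a ≠ 0 := by rintro rfl; nlinarith [sq_nonneg b]
  set s := Real.sqrt (a * c - b ^ 2) with hs
  have hspos : 0 < s := Real.sqrt_pos.mpr (by linarith)
  have hs2 : s ^ 2 = a * c - b ^ 2 := Real.sq_sqrt (by linarith)
  have ha2 : 0 < |a| := abs_pos.mpr ha
  have hz : (a : ℂ) * (⟨-b / a, s / |a|⟩ : ℂ) ^ 2 + 2 * b * ⟨-b / a, s / |a|⟩ + c = 0 := by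
    have e1 : (s / |a|) ^ 2 = (a * c - b ^ 2) / a ^ 2 := by rw [div_pow, hs2, sq_abs]
    apply Complex.ext
    · simp [pow_two]
      rw [pow_two] at e1
      rw [e1]
      field_simp
      ring
    · simp [pow_two]
      field_simp
      ring
  exact h _ (by simpa using div_pos hspos ha2) hz

lemma mixedDisc2_pd {n : ℕ} (A : Fin n → Matrix (Fin (n + 2)) (Fin (n + 2)) ℂ)
    (hA : ∀ i, (A i).PosDef)
    (A' B : Matrix (Fin (n + 2)) (Fin (n + 2)) ℂ)
    (hA' : A'.PosDef) (hB : B.IsHermitian) :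
    mixedDisc2 A A' A' * mixedDisc2 A B B ≤ (mixedDisc2 A A' B) ^ 2 := by
  let M := Matrix (Fin (n + 2)) (Fin (n + 2)) ℂ
  set Q : M → M → ℂ := fun X Y =>
    mixF (n + 2) (Fin.snoc (Fin.snoc A X : Fin (n + 1) → M) Y : Fin (n + 2) → M) with hQ
  have hsymm : ∀ X Y, Q X Y = Q Y X := by
    intro X Y
    simp only [hQ]
    rw [← mixF_symm (Equiv.swap (Fin.last (n + 1)) (Fin.last n).castSucc)]
    congr 1
    ext i : 1
    refine Fin.lastCases ?_ (fun j => ?_) i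
    · simp
    · refine Fin.lastCases ?_ (fun k => ?_) j
      · simp
      · rw [Equiv.swap_apply_of_ne_of_ne]
        · simp
        · exact (Fin.castSucc_lt_last _).ne
        · intro h
          exact (Fin.castSucc_lt_last k).ne (Fin.castSucc_injective _ h)
  have hadd : ∀ X Y Z, Q X (Y + Z) = Q X Y + Q X Z := fun X Y Z => MultilinearMap.snoc_add _ _ _ _
  have hsmul : ∀ X (t : ℂ) Y, Q X (t • Y) = t * Q X Y := fun X t Y =>
    MultilinearMap.snoc_smul _ _ _ _
  have hreal : ∀ X Y : M, X.IsHermitian → Y.IsHermitian → Q X Y = ((Q X Y).re : ℂ) := by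
    intro X Y hX hY
    exact (Complex.conj_eq_iff_re.mp (mixF_conj _ (snoc_herm _ _ Matrix.IsHermitian
      (snoc_herm _ _ Matrix.IsHermitian (fun i => (hA i).1) hX) hY))).symm
  have hne : ∀ Z ∈ upperH (n + 2), Q Z Z ≠ 0 := by
    intro Z hZ
    have h := mixF_ne (Fin.snoc (Fin.snoc A 1 : Fin (n + 1) → M) 1 : Fin (n + 2) → M)
      (snoc_herm _ _ Matrix.PosDef (snoc_herm _ _ Matrix.PosDef hA Matrix.PosDef.one)
        Matrix.PosDef.one) (Finset.univ.filter fun i => i.val < n) Z hZ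
    have e : (Finset.univ.filter fun i : Fin (n + 2) => i.val < n).piecewise
        (Fin.snoc (Fin.snoc A 1 : Fin (n + 1) → M) 1 : Fin (n + 2) → M) (fun _ => Z)
        = (Fin.snoc (Fin.snoc A Z : Fin (n + 1) → M) Z : Fin (n + 2) → M) := by
      ext i : 1
      refine Fin.lastCases ?_ (fun j => ?_) i
      · simp [Finset.piecewise]
      · refine Fin.lastCases ?_ (fun k => ?_) j
        · simp [Finset.piecewise]
        · simp [Finset.piecewise]
    rw [e] at h
    exact h
  have key : (Q A' A').re * (Q B B).re ≤ (Q A' B).re ^ 2 := by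
    apply real_quad
    intro t ht
    rw [← hreal _ _ hA'.1 hA'.1, ← hreal _ _ hA'.1 hB, ← hreal _ _ hB hB]
    have h := hne _ (upperH_mk hA' hB t ht)
    rw [hadd, hsmul, hsymm _ B, hsymm _ A', hadd, hadd, hsmul, hsmul, hsymm B A'] at h
    convert h using 1
    ring
  have e : ∀ X Y, mixedDisc2 A X Y = ((n + 2).factorial : ℝ)⁻¹ * (Q X Y).re := fun X Y =>
    mixedDisc_eq _
  rw [e, e, e]
  have := mul_le_mul_of_nonneg_left key (sq_nonneg ((n + 2).factorial : ℝ)⁻¹)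
  linarith

lemma continuous_mixedDisc {m : ℕ} :
    Continuous (mixedDisc : (Fin m → Matrix (Fin m) (Fin m) ℂ) → ℝ) := by
  unfold mixedDisc
  refine Complex.continuous_re.comp (continuous_const.mul (continuous_finsetSum _ fun σ _ => ?_))
  refine Continuous.matrix_det (continuous_matrix fun i j => ?_)
  simp only [Matrix.of_apply]
  exact (continuous_apply (σ j)).matrix_elem i j

theorem stmt8 {n : ℕ} (A : Fin n → Matrix (Fin (n + 2)) (Fin (n + 2)) ℂ)
    (hA : ∀ i, (A i).PosSemidef)
    (A' B : Matrix (Fin (n + 2)) (Fin (n + 2)) ℂ)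
    (hA' : A'.PosSemidef) (hB : B.IsHermitian) :
    (mixedDisc2 A A' B) ^ 2 ≥ mixedDisc2 A A' A' * mixedDisc2 A B B := by
  let M := Matrix (Fin (n + 2)) (Fin (n + 2)) ℂ
  let E : ℝ → Fin n → M := fun ε i => A i + (ε : ℂ) • 1
  let E' : ℝ → M := fun ε => A' + (ε : ℂ) • 1
  have hE : Continuous E := by fun_prop
  have hE' : Continuous E' := by fun_prop
  have hc : ∀ X Y : ℝ → M, Continuous X → Continuous Y →
      Continuous fun ε => mixedDisc2 (E ε) (X ε) (Y ε) := by
    intro X Y hX hY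
    exact continuous_mixedDisc.comp (Continuous.finSnoc (Continuous.finSnoc hE hX) hY)
  have c1 : Continuous fun ε => mixedDisc2 (E ε) (E' ε) (E' ε) * mixedDisc2 (E ε) B B :=
    (hc E' E' hE' hE').mul (hc (fun _ => B) (fun _ => B) continuous_const continuous_const)
  have c2 : Continuous fun ε => (mixedDisc2 (E ε) (E' ε) B) ^ 2 :=
    (hc E' (fun _ => B) hE' continuous_const).pow 2
  have hpd : ∀ (X : M), X.PosSemidef → ∀ ε : ℝ, 0 < ε → (X + (ε : ℂ) • 1).PosDef :=
    fun X hX ε hε => Matrix.PosDef.posSemidef_add hX (posDef_real_smul Matrix.PosDef.one ε hε)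
  have t1 := (c1.tendsto 0).mono_left (nhdsWithin_le_nhds (s := Set.Ioi 0))
  have t2 := (c2.tendsto 0).mono_left (nhdsWithin_le_nhds (s := Set.Ioi 0))
  have := le_of_tendsto_of_tendsto t1 t2 (by
    filter_upwards [self_mem_nhdsWithin] with ε hε
    exact mixedDisc2_pd _ (fun i => hpd _ (hA i) ε hε) _ _ (hpd _ hA' ε hε) hB)
  simpa [E, E'] using this
end

section
/- Let A₁, …, A_{n-2}, A be positive semidefinite n×n Hermitian matrices with D(A₁,…,A_{n-2},A,A) > 0, and let B be Hermitian. Then D(A₁,…,A_{n-2},A,B)² = D(A₁,…,A_{n-2},A,A)·D(A₁,…,A_{n-2},B,B) holds if and only if the linear functionals D(A₁,…,A_{n-2},A,·) and D(A₁,…,A_{n-2},B,·) on Hermitian matrices are proportional. -/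
open scoped ComplexOrder

namespace MDisc

open Finset

/-- The multilinear map underlying one summand. -/
noncomputable def colDet (m : ℕ) :
    MultilinearMap ℂ (fun _ : Fin m => Matrix (Fin m) (Fin m) ℂ) ℂ :=
  (Matrix.detRowAlternating (n := Fin m) (R := ℂ)).toMultilinearMap.compLinearMap
    (fun j => (LinearMap.pi fun i => (LinearMap.proj j).comp
      (LinearMap.proj i : Matrix (Fin m) (Fin m) ℂ →ₗ[ℂ] (Fin m → ℂ))))

lemma colDet_apply {m : ℕ} (A : Fin m → Matrix (Fin m) (Fin m) ℂ) :
    colDet m A = (Matrix.of fun i j => A j i j).det := by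
  rw [← Matrix.det_transpose]
  rfl

/-- Complex, unnormalised mixed discriminant. -/
noncomputable def F (m : ℕ) :
    MultilinearMap ℂ (fun _ : Fin m => Matrix (Fin m) (Fin m) ℂ) ℂ :=
  ∑ σ : Equiv.Perm (Fin m), (colDet m).domDomCongr σ

lemma F_apply {m : ℕ} (A : Fin m → Matrix (Fin m) (Fin m) ℂ) :
    F m A = ∑ σ : Equiv.Perm (Fin m), (Matrix.of fun i j => A (σ j) i j).det := by
  simp [F, colDet_apply]

lemma mixedDisc_eq {m : ℕ} (A : Fin m → Matrix (Fin m) (Fin m) ℂ) :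
    mixedDisc A = (m.factorial : ℝ)⁻¹ * (F m A).re := by
  unfold mixedDisc
  rw [← F_apply]
  rw [show ((m.factorial : ℂ)⁻¹) = (((m.factorial : ℝ)⁻¹ : ℝ) : ℂ) by push_cast; rfl]
  exact Complex.re_ofReal_mul _ _

lemma F_perm {m : ℕ} (A : Fin m → Matrix (Fin m) (Fin m) ℂ) (π : Equiv.Perm (Fin m)) :
    F m (fun i => A (π i)) = F m A := by
  rw [F_apply, F_apply]
  exact Fintype.sum_equiv (Equiv.mulLeft π) _ _ (fun σ => rfl)

lemma F_const {m : ℕ} (Y : Matrix (Fin m) (Fin m) ℂ) :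
    F m (fun _ => Y) = m.factorial * Y.det := by
  rw [F_apply]
  have : (Matrix.of fun i j => Y i j) = Y := rfl
  simp [this, Fintype.card_perm]

lemma F_conj {m : ℕ} (A : Fin m → Matrix (Fin m) (Fin m) ℂ) (hA : ∀ i, (A i).IsHermitian) :
    star (F m A) = F m A := by
  rw [F_apply, star_sum]
  have h1 : ∀ σ : Equiv.Perm (Fin m), star (Matrix.of fun i j => A (σ j) i j).det
      = (Matrix.of fun i j => A (σ i) i j).det := by
    intro σ
    rw [← Matrix.det_conjTranspose]
    congr 1
    ext i j
    simp only [Matrix.conjTranspose_apply, Matrix.of_apply]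
    exact (hA _).apply _ _
  simp_rw [h1, Matrix.det_apply, Matrix.of_apply]
  rw [sum_comm]
  conv_rhs => rw [sum_comm]
  refine sum_congr rfl fun τ _ => ?_
  exact Fintype.sum_equiv (Equiv.mulRight τ) _ _ (fun σ => rfl)

lemma F_real {m : ℕ} (A : Fin m → Matrix (Fin m) (Fin m) ℂ) (hA : ∀ i, (A i).IsHermitian) :
    (((F m A).re : ℝ) : ℂ) = F m A :=
  Complex.conj_eq_iff_re.1 (F_conj A hA)

/-- Matrices with positive definite imaginary part. -/
def U {m : ℕ} (Y : Matrix (Fin m) (Fin m) ℂ) : Prop :=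
  ∀ v : Fin m → ℂ, v ≠ 0 → 0 < (star v ⬝ᵥ (Y.mulVec v)).im

lemma U_det {m : ℕ} {Y : Matrix (Fin m) (Fin m) ℂ} (h : U Y) : Y.det ≠ 0 := by
  intro h0
  obtain ⟨v, hv, hv0⟩ := Matrix.exists_mulVec_eq_zero_iff.2 h0
  have := h v hv
  simp [hv0] at this

lemma quad_smul {m : ℕ} (Y : Matrix (Fin m) (Fin m) ℂ) (z : ℂ) (v : Fin m → ℂ) :
    star v ⬝ᵥ ((z • Y).mulVec v) = z * (star v ⬝ᵥ (Y.mulVec v)) := by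
  rw [Matrix.smul_mulVec, dotProduct_smul, smul_eq_mul]

lemma U_add {m : ℕ} {Y P : Matrix (Fin m) (Fin m) ℂ} (h : U Y) (hP : P.PosSemidef) {z : ℂ}
    (hz : 0 ≤ z.im) : U (Y + z • P) := by
  intro v hv
  have h1 := h v hv
  have h2 := hP.dotProduct_mulVec_nonneg v
  rw [Complex.le_def] at h2
  obtain ⟨h2, h3⟩ := h2
  simp only [Complex.zero_re, Complex.zero_im] at h2 h3
  rw [Matrix.add_mulVec, dotProduct_add, quad_smul, Complex.add_im, Complex.mul_im, ← h3]
  have := mul_nonneg hz h2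
  linarith

lemma U_herm {m : ℕ} {X P : Matrix (Fin m) (Fin m) ℂ} (h : X.IsHermitian) (hP : P.PosDef) {z : ℂ}
    (hz : 0 < z.im) : U (X + z • P) := by
  intro v hv
  have h1 : (star v ⬝ᵥ (X.mulVec v)).im = 0 := by
    exact h.im_star_dotProduct_mulVec_self v
  have h2 := hP.dotProduct_mulVec_pos hv
  rw [Complex.lt_def] at h2
  obtain ⟨h2, h3⟩ := h2
  simp only [Complex.zero_re, Complex.zero_im] at h2 h3
  rw [Matrix.add_mulVec, dotProduct_add, quad_smul, Complex.add_im, Complex.mul_im, ← h3, h1]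
  have := mul_pos hz h2
  linarith

/-- The key polynomial fact. -/
lemma poly_coeff_one {q : Polynomial ℂ} (hd : q.natDegree ≠ 0)
    (hq : ∀ z : ℂ, 0 ≤ z.im → q.eval z ≠ 0) : q.coeff 1 ≠ 0 := by
  intro h0
  have hq' : q.derivative ≠ 0 := fun h => hd (Polynomial.derivative_eq_zero.1 h)
  have hroot : (0 : ℂ) ∈ q.derivative.rootSet ℂ := by
    rw [Polynomial.mem_rootSet]
    refine ⟨hq', ?_⟩
    rw [Polynomial.coe_aeval_eq_eval, ← Polynomial.coeff_zero_eq_eval_zero,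
      Polynomial.coeff_derivative]
    simp [h0]
  have hsub := Polynomial.rootSet_derivative_subset_convexHull_rootSet
    (Polynomial.natDegree_pos_iff_degree_pos.1 (Nat.pos_of_ne_zero hd)) hroot
  have hconv : Convex ℝ {z : ℂ | z.im < 0} := convex_halfSpace_im_lt 0
  have := convexHull_min (s := q.rootSet ℂ) (t := {z : ℂ | z.im < 0}) (fun z hz => by
    rw [Polynomial.mem_rootSet] at hz
    have h2 := hz.2
    rw [Polynomial.coe_aeval_eq_eval] at h2
    by_contra hcon
    simp only [Set.mem_ofPred_eq, not_lt] at hcon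
    exact hq z hcon h2) hconv hsub
  simp at this

lemma F_ne {m : ℕ} (A : Fin m → Matrix (Fin m) (Fin m) ℂ) (hA : ∀ i, (A i).PosDef)
    (T : Finset (Fin m)) : ∀ Y : Matrix (Fin m) (Fin m) ℂ, U Y →
    F m (T.piecewise A (fun _ => Y)) ≠ 0 := by
  induction T using Finset.induction_on with
  | empty =>
    intro Y hY
    rw [Finset.piecewise_empty, F_const]
    exact mul_ne_zero (by exact_mod_cast m.factorial_ne_zero) (U_det hY)
  | insert a T haT ih =>
    intro Y hY
    set base : Fin m → Matrix (Fin m) (Fin m) ℂ := T.piecewise A (fun _ => Y) with hbase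
    let q : Polynomial ℂ := ∑ s ∈ (Tᶜ).powerset,
      Polynomial.C (F m (s.piecewise (fun _ => A a) base)) * Polynomial.X ^ s.card
    have heval : ∀ z : ℂ, q.eval z = F m (T.piecewise A (fun _ => Y + z • A a)) := by
      intro z
      have h1 : T.piecewise A (fun _ => Y + z • A a)
          = (Tᶜ).piecewise ((fun _ => z • A a) + base) base := by
        ext1 i
        by_cases hi : i ∈ T <;> simp [hbase, hi, add_comm]
      rw [h1, MultilinearMap.map_piecewise_add, Polynomial.eval_finsetSum]
      refine sum_congr rfl fun s _ => ?_
      have h2 := (F m).map_piecewise_smul (fun _ => z) (s.piecewise (fun _ => A a) base) s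
      have h3 : s.piecewise (fun i => z • (s.piecewise (fun _ => A a) base) i)
          (s.piecewise (fun _ => A a) base) = s.piecewise (fun _ => z • A a) base := by
        ext1 i
        by_cases hi : i ∈ s <;> simp [hi]
      rw [h3] at h2
      rw [h2]
      rw [Finset.prod_const, Polynomial.eval_mul, Polynomial.eval_C, Polynomial.eval_pow,
        Polynomial.eval_X, smul_eq_mul, mul_comm]
    have hcoeff : ∀ k, q.coeff k = ∑ s ∈ (Tᶜ).powersetCard k,
        F m (s.piecewise (fun _ => A a) base) := by
      intro k
      simp only [q, Polynomial.finsetSum_coeff, Polynomial.coeff_C_mul, Polynomial.coeff_X_pow]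
      rw [Finset.powersetCard_eq_filter, sum_filter]
      refine sum_congr rfl fun s _ => ?_
      by_cases h : k = s.card
      · simp [h]
      · simp [h, Ne.symm h]
    have htop : q.coeff (Tᶜ).card = F m (T.piecewise A (fun _ => A a)) := by
      rw [hcoeff, powersetCard_self, sum_singleton]
      congr 1
      ext1 i
      by_cases hi : i ∈ T <;> simp [hbase, hi]
    have htop0 : q.coeff (Tᶜ).card ≠ 0 := by
      rw [htop]
      have h1 := ih (Complex.I • A a) (by
        simpa using U_herm (X := 0) (by simp [Matrix.IsHermitian]) (hA a) (z := Complex.I) (by simp))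
      have h2 := (F m).map_piecewise_smul (fun _ => Complex.I) (T.piecewise A (fun _ => A a)) Tᶜ
      have h3 : (Tᶜ).piecewise (fun i => Complex.I • (T.piecewise A (fun _ => A a)) i)
          (T.piecewise A (fun _ => A a)) = T.piecewise A (fun _ => Complex.I • A a) := by
        ext1 i
        by_cases hi : i ∈ T <;> simp [hi]
      rw [h3] at h2
      rw [h2] at h1
      exact right_ne_zero_of_smul h1
    have hne : (Tᶜ).card ≠ 0 := by
      rw [Ne, card_eq_zero]
      intro h
      have : a ∈ Tᶜ := by simpa using haT
      simp [h] at this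
    have hdeg : q.natDegree ≠ 0 := by
      have := Polynomial.le_natDegree_of_ne_zero htop0
      omega
    have hc := poly_coeff_one hdeg (fun z hz => by
      rw [heval]
      exact ih _ (U_add hY (hA a).posSemidef hz))
    have hone : q.coeff 1 = (Tᶜ).card * F m ((insert a T).piecewise A (fun _ => Y)) := by
      rw [hcoeff, powersetCard_one, sum_map, ← nsmul_eq_mul, ← sum_const]
      refine sum_congr rfl fun i hi => ?_
      rw [← F_perm _ (Equiv.swap i a)]
      congr 1
      ext1 j
      have hiT : i ∉ T := by simpa using hi
      by_cases hja : j = a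
      · subst hja
        simp
      · by_cases hji : j = i
        · subst hji
          simp [hja, hiT, hbase, haT, Finset.piecewise, Ne.symm hja]
        · rw [Equiv.swap_apply_of_ne_of_ne hji hja]
          simp [hja, hji, hbase, Finset.piecewise]
    rw [hone] at hc
    exact right_ne_zero_of_mul hc

section bil
variable {n : ℕ} (A : Fin n → Matrix (Fin (n + 2)) (Fin (n + 2)) ℂ)

/-- Complex bilinear form. -/
noncomputable def Q (X Y : Matrix (Fin (n + 2)) (Fin (n + 2)) ℂ) : ℂ :=
  F (n + 2) (Fin.snoc (Fin.snoc A X : Fin (n + 1) → Matrix (Fin (n + 2)) (Fin (n + 2)) ℂ) Y :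
    Fin (n + 2) → Matrix (Fin (n + 2)) (Fin (n + 2)) ℂ)

lemma md2_eq (X Y : Matrix (Fin (n + 2)) (Fin (n + 2)) ℂ) :
    mixedDisc2 A X Y = ((n + 2).factorial : ℝ)⁻¹ * (Q A X Y).re := by
  unfold mixedDisc2
  rw [mixedDisc_eq]; rfl

lemma Q_add (X Y Z : Matrix (Fin (n + 2)) (Fin (n + 2)) ℂ) :
    Q A X (Y + Z) = Q A X Y + Q A X Z := by
  have := (F (n + 2)).map_update_add (Fin.snoc (Fin.snoc A X : Fin (n + 1) → Matrix (Fin (n + 2)) (Fin (n + 2)) ℂ) Y :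
    Fin (n + 2) → Matrix (Fin (n + 2)) (Fin (n + 2)) ℂ) (Fin.last _) Y Z
  simpa only [Fin.update_snoc_last, Q] using this

lemma Q_smul (X Y : Matrix (Fin (n + 2)) (Fin (n + 2)) ℂ) (c : ℂ) :
    Q A X (c • Y) = c * Q A X Y := by
  have := (F (n + 2)).map_update_smul (Fin.snoc (Fin.snoc A X : Fin (n + 1) → Matrix (Fin (n + 2)) (Fin (n + 2)) ℂ) Y :
    Fin (n + 2) → Matrix (Fin (n + 2)) (Fin (n + 2)) ℂ) (Fin.last _) c Y
  simpa only [Fin.update_snoc_last, smul_eq_mul, Q] using this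

lemma Q_symm (X Y : Matrix (Fin (n + 2)) (Fin (n + 2)) ℂ) : Q A X Y = Q A Y X := by
  unfold Q
  rw [← F_perm _ (Equiv.swap (Fin.last _) (Fin.castSucc (Fin.last _)))]
  congr 1
  ext1 j
  induction j using Fin.lastCases with
  | last => simp
  | cast j =>
    induction j using Fin.lastCases with
    | last => simp
    | cast j =>
      rw [Equiv.swap_apply_of_ne_of_ne]
      · simp
      · exact (Fin.castSucc_lt_last _).ne
      · exact fun h => (Fin.castSucc_lt_last j).ne (Fin.castSucc_injective _ h)

lemma Q_real (hA : ∀ i, (A i).IsHermitian) {X Y : Matrix (Fin (n + 2)) (Fin (n + 2)) ℂ}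
    (hX : X.IsHermitian) (hY : Y.IsHermitian) : (((Q A X Y).re : ℝ) : ℂ) = Q A X Y := by
  apply F_real
  intro j
  induction j using Fin.lastCases with
  | last => simpa
  | cast j =>
    induction j using Fin.lastCases with
    | last => simpa
    | cast j => simpa using hA j

lemma Q_ne (hA : ∀ i, (A i).PosDef) {Y : Matrix (Fin (n + 2)) (Fin (n + 2)) ℂ} (hY : U Y) :
    Q A Y Y ≠ 0 := by
  have h := F_ne (Fin.snoc (Fin.snoc A 1 : Fin (n + 1) → Matrix (Fin (n + 2)) (Fin (n + 2)) ℂ) 1 :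
    Fin (n + 2) → Matrix (Fin (n + 2)) (Fin (n + 2)) ℂ) (by
      intro j
      induction j using Fin.lastCases with
      | last => simpa using Matrix.PosDef.one
      | cast j =>
        induction j using Fin.lastCases with
        | last => simpa using Matrix.PosDef.one
        | cast j => simpa using hA j) (univ.filter fun i => (i : ℕ) < n) Y hY
  unfold Q
  convert h using 2
  ext1 j
  induction j using Fin.lastCases with
  | last => simp [Finset.piecewise]
  | cast j =>
    induction j using Fin.lastCases with
    | last => simp [Finset.piecewise]
    | cast j => simp [Finset.piecewise]

lemma alex_pd (hA : ∀ i, (A i).PosDef) {P X : Matrix (Fin (n + 2)) (Fin (n + 2)) ℂ}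
    (hP : P.PosDef) (hX : X.IsHermitian) :
    (Q A P P).re * (Q A X X).re ≤ (Q A P X).re ^ 2 := by
  by_contra hcon
  push Not at hcon
  have e : ∀ w : ℂ, Q A (X + w • P) (X + w • P)
      = Q A X X + 2 * w * Q A P X + w ^ 2 * Q A P P := by
    intro w
    rw [Q_add, Q_smul, Q_symm A _ X, Q_symm A _ P, Q_add, Q_add, Q_smul, Q_smul, Q_symm A X P]
    ring
  have hr1 := Q_real A (fun i => (hA i).isHermitian) hP.isHermitian hP.isHermitian
  have hr2 := Q_real A (fun i => (hA i).isHermitian) hP.isHermitian hX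
  have hr3 := Q_real A (fun i => (hA i).isHermitian) hX hX
  set a := (Q A P P).re
  set b := (Q A P X).re
  set c := (Q A X X).re
  have ha : a ≠ 0 := by
    rintro h
    rw [h] at hcon
    nlinarith [sq_nonneg b]
  have hd : 0 < a * c - b ^ 2 := by linarith
  have hs : 0 < Real.sqrt (a * c - b ^ 2) := Real.sqrt_pos.2 hd
  have hs2 := Real.sq_sqrt hd.le
  set s := Real.sqrt (a * c - b ^ 2)
  let w : ℂ := ⟨-b / a, s / |a|⟩
  have hw : 0 < w.im := div_pos hs (abs_pos.2 ha)
  refine Q_ne A hA (U_herm hX hP hw) ?_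
  rw [e, ← hr1, ← hr2, ← hr3]
  have habs : |a| ^ 2 = a ^ 2 := sq_abs a
  have habs0 : |a| ≠ 0 := abs_ne_zero.2 ha
  have hq : (s / |a|) ^ 2 = (a * c - b ^ 2) / a ^ 2 := by rw [div_pow, hs2, habs]
  apply Complex.ext
  · simp only [Complex.add_re, Complex.mul_re, Complex.ofReal_re, Complex.ofReal_im, pow_two,
      Complex.mul_im, w, Complex.re_ofNat, Complex.im_ofNat, Complex.zero_re]
    rw [show s / |a| * (s / |a|) = (a * c - b ^ 2) / a ^ 2 by rw [← hq]; ring]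
    field_simp
    ring
  · simp only [Complex.add_im, Complex.mul_re, Complex.ofReal_re, Complex.ofReal_im, pow_two,
      Complex.mul_im, w, Complex.re_ofNat, Complex.im_ofNat, Complex.zero_im]
    field_simp
    ring

lemma Q_cont (P X Y Z : Matrix (Fin (n + 2)) (Fin (n + 2)) ℂ) (a b : ℝ) :
    Continuous fun t : ℝ => (Q (fun i => A i + (t : ℂ) • 1) (X + ((a * t : ℝ) : ℂ) • P)
      (Y + ((b * t : ℝ) : ℂ) • Z)).re := by
  apply Complex.continuous_re.comp
  unfold Q
  simp_rw [F_apply]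
  refine continuous_finsetSum _ fun σ _ => ?_
  apply Continuous.matrix_det
  refine continuous_matrix fun i j => ?_
  simp only [Matrix.of_apply]
  generalize σ j = k
  induction k using Fin.lastCases with
  | last => simp only [Fin.snoc_last, Matrix.add_apply, Matrix.smul_apply]; fun_prop
  | cast k =>
    induction k using Fin.lastCases with
    | last =>
      simp only [Fin.snoc_last, Fin.snoc_castSucc, Matrix.add_apply, Matrix.smul_apply]; fun_prop
    | cast k => simp only [Fin.snoc_castSucc, Matrix.add_apply, Matrix.smul_apply]; fun_prop

lemma alex (hA : ∀ i, (A i).PosSemidef) {P X : Matrix (Fin (n + 2)) (Fin (n + 2)) ℂ}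
    (hP : P.PosSemidef) (hX : X.IsHermitian) :
    (Q A P P).re * (Q A X X).re ≤ (Q A P X).re ^ 2 := by
  have c1 := Q_cont A 1 P P 1 1 1
  have c2 := Q_cont A 1 P X 1 1 0
  have c3 := Q_cont A 1 X X 1 0 0
  have key : ∀ t : ℝ, 0 < t → _ ≤ _ := fun t ht =>
    alex_pd (fun i => A i + (t : ℂ) • 1)
      (fun i => Matrix.PosDef.posSemidef_add (hA i)
        (Matrix.PosDef.smul Matrix.PosDef.one (by exact_mod_cast ht)))
      (P := P + (t : ℂ) • 1) (X := X)
      (Matrix.PosDef.posSemidef_add hP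
        (Matrix.PosDef.smul Matrix.PosDef.one (by exact_mod_cast ht))) hX
  simp only [one_mul, zero_mul, Complex.ofReal_zero, zero_smul, add_zero] at c1 c2 c3
  have l1 := ((c1.mul c3).tendsto 0).mono_left (nhdsWithin_le_nhds (s := Set.Ioi 0))
  have l2 := ((c2.pow 2).tendsto 0).mono_left (nhdsWithin_le_nhds (s := Set.Ioi 0))
  have := le_of_tendsto_of_tendsto l1 l2 (by
    filter_upwards [self_mem_nhdsWithin] with t ht
    exact key t ht)
  simpa using this

end bil

end MDisc

theorem stmt9 {n : ℕ} (A : Fin n → Matrix (Fin (n + 2)) (Fin (n + 2)) ℂ)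
    (hA : ∀ i, (A i).PosSemidef)
    (A' B : Matrix (Fin (n + 2)) (Fin (n + 2)) ℂ)
    (hA' : A'.PosSemidef) (hB : B.IsHermitian)
    (hpos : 0 < mixedDisc2 A A' A') :
    (mixedDisc2 A A' B) ^ 2 = mixedDisc2 A A' A' * mixedDisc2 A B B ↔
      ∃ c : ℝ, ∀ C : Matrix (Fin (n + 2)) (Fin (n + 2)) ℂ, C.IsHermitian →
        mixedDisc2 A B C = c * mixedDisc2 A A' C := by
  have hsymm : ∀ X Y, mixedDisc2 A X Y = mixedDisc2 A Y X := fun X Y => by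
    rw [MDisc.md2_eq, MDisc.md2_eq, MDisc.Q_symm]
  have hadd : ∀ X Y Z, mixedDisc2 A X (Y + Z) = mixedDisc2 A X Y + mixedDisc2 A X Z :=
    fun X Y Z => by
      simp only [MDisc.md2_eq, MDisc.Q_add, Complex.add_re]; ring
  have hsmul : ∀ X Y (c : ℝ), mixedDisc2 A X ((c : ℂ) • Y) = c * mixedDisc2 A X Y :=
    fun X Y c => by
      simp only [MDisc.md2_eq, MDisc.Q_smul, Complex.re_ofReal_mul]; ring
  have halex : ∀ X : Matrix (Fin (n + 2)) (Fin (n + 2)) ℂ, X.IsHermitian →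
      mixedDisc2 A A' A' * mixedDisc2 A X X ≤ mixedDisc2 A A' X ^ 2 := by
    intro X hX
    have h := MDisc.alex A hA hA' hX
    simp only [MDisc.md2_eq]
    have h2 := mul_le_mul_of_nonneg_left h (sq_nonneg (((n + 2).factorial : ℝ)⁻¹))
    linarith
  constructor
  · intro heq
    set q := mixedDisc2 A A' A' with hq
    refine ⟨mixedDisc2 A A' B / q, fun C hC => ?_⟩
    have herm : ∀ (c : ℝ) (X : Matrix (Fin (n + 2)) (Fin (n + 2)) ℂ), X.IsHermitian →
        ((c : ℂ) • X).IsHermitian := by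
      intro c X hX
      unfold Matrix.IsHermitian
      rw [Matrix.conjTranspose_smul, hX.eq]
      simp
    set b := mixedDisc2 A A' B with hb
    set d := mixedDisc2 A A' C with hd
    set e := mixedDisc2 A B C with he
    set f := mixedDisc2 A B B with hf
    set g := mixedDisc2 A C C with hg
    have main : ∀ x y z : ℝ, q * (x ^ 2 * q + y ^ 2 * f + z ^ 2 * g + 2 * x * y * b
        + 2 * x * z * d + 2 * y * z * e) ≤ (x * q + y * b + z * d) ^ 2 := by
      intro x y z
      have h := halex (((x : ℂ) • A' + (y : ℂ) • B) + (z : ℂ) • C)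
        (((herm x _ hA'.isHermitian).add (herm y _ hB)).add (herm z _ hC))
      have e1 : ∀ W, mixedDisc2 A W (((x : ℂ) • A' + (y : ℂ) • B) + (z : ℂ) • C)
          = x * mixedDisc2 A W A' + y * mixedDisc2 A W B + z * mixedDisc2 A W C := by
        intro W
        rw [hadd, hadd, hsmul, hsmul, hsmul]
      rw [e1, e1, hsymm _ A', hsymm _ B, hsymm _ C, e1, e1, e1, hsymm B A', hsymm C A',
        hsymm C B] at h
      simp only [← hq, ← hb, ← hd, ← he, ← hf, ← hg] at h
      linarith
    have hq0 : q ≠ 0 := hpos.ne'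
    by_contra hne
    have hk : q * e - b * d ≠ 0 := by
      intro h
      apply hne
      field_simp
      linarith
    have key : ∀ y : ℝ, (q * g - d ^ 2) + 2 * y * (q * e - b * d) ≤ 0 := by
      intro y
      have := main 0 y 1
      nlinarith
    generalize q * e - b * d = k at hk key
    have := key ((1 - (q * g - d ^ 2)) / (2 * k))
    rw [show 2 * ((1 - (q * g - d ^ 2)) / (2 * k)) * k
      = 1 - (q * g - d ^ 2) by field_simp] at this
    linarith
  · rintro ⟨c, hc⟩
    have h1 := hc A' hA'.isHermitian
    have h2 := hc B hB
    rw [hsymm B A'] at h1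
    rw [h2, h1]
    ring
end

section
/- Let A₁, …, A_{n-2}, A be positive semidefinite n×n Hermitian matrices with D(A₁,…,A_{n-2},A,A) ≠ 0. If B is Hermitian with D(A₁,…,A_{n-2},A,B) = 0 and D(A₁,…,A_{n-2},B,B) = 0, then D(A₁,…,A_{n-2},B,C) = 0 for every Hermitian matrix C. -/
open scoped ComplexOrder

namespace MixedAux

abbrev Mat (m : ℕ) := Matrix (Fin m) (Fin m) ℂ

/-- Product form over columns as a multilinear map. -/
noncomputable def colM (m : ℕ) : MultilinearMap ℂ (fun _ : Fin m => Mat m) ℂ :=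
  (Matrix.detRowAlternating (n := Fin m) (R := ℂ)).toMultilinearMap.compLinearMap
    (fun j => (LinearMap.pi fun i => Matrix.entryLinearMap ℂ ℂ i j))

noncomputable def F (m : ℕ) : MultilinearMap ℂ (fun _ : Fin m => Mat m) ℂ :=
  ∑ σ : Equiv.Perm (Fin m), (colM m).domDomCongr σ

lemma F_apply {m : ℕ} (A : Fin m → Mat m) :
    F m A = ∑ σ : Equiv.Perm (Fin m), (Matrix.of fun i j => A (σ j) i j).det := by
  simp only [F, MultilinearMap.sum_apply]
  refine Finset.sum_congr rfl fun σ _ => ?_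
  rw [← Matrix.det_transpose]
  rfl

lemma F_perm {m : ℕ} (A : Fin m → Mat m) (τ : Equiv.Perm (Fin m)) :
    F m (fun i => A (τ i)) = F m A := by
  rw [F_apply, F_apply]
  exact Fintype.sum_equiv (Equiv.mulLeft τ) _ _ (fun σ => rfl)

lemma F_const {m : ℕ} (Z : Mat m) : F m (fun _ => Z) = (m.factorial : ℂ) * Z.det := by
  rw [F_apply]
  have : (Matrix.of fun i j => Z i j) = Z := rfl
  simp [this, Fintype.card_perm]

lemma F_conj {m : ℕ} (A : Fin m → Mat m) (hA : ∀ i, (A i).IsHermitian) :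
    (starRingEnd ℂ) (F m A) = F m A := by
  have key : F m A = ∑ τ : Equiv.Perm (Fin m), ∑ σ : Equiv.Perm (Fin m),
      ((Equiv.Perm.sign τ : ℤ) : ℂ) * ∏ j, A (σ j) (τ j) j := by
    rw [F_apply, Finset.sum_comm]
    refine Finset.sum_congr rfl fun σ _ => ?_
    rw [Matrix.det_apply']
    rfl
  rw [key, map_sum]
  refine Fintype.sum_equiv (Equiv.inv _) _ _ (fun τ => ?_)
  rw [map_sum]
  refine Fintype.sum_equiv (Equiv.mulRight τ⁻¹) _ _ (fun σ => ?_)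
  simp only [Equiv.inv_apply, Equiv.coe_mulRight, map_mul, map_prod, Equiv.Perm.sign_inv]
  congr 1
  · simp
  · refine Fintype.prod_equiv τ _ _ (fun j => ?_)
    have h : τ⁻¹ (τ j) = j := τ.symm_apply_apply j
    rw [Equiv.Perm.mul_apply, h]
    exact (hA (σ j)).apply j (τ j)


noncomputable def pol {m : ℕ} (a b : Fin m → Mat m) : Polynomial ℂ :=
  ∑ S : Finset (Fin m), Polynomial.C (F m (S.piecewise b a)) * Polynomial.X ^ S.card

lemma pol_eval {m : ℕ} (a b : Fin m → Mat m) (s : ℂ) :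
    (pol a b).eval s = F m (fun i => a i + s • b i) := by
  have h := (F m).map_add_univ (fun i => s • b i) a
  have h2 : (fun i => a i + s • b i) = (fun i => s • b i) + a := by
    funext i; simp [add_comm]
  rw [h2, h, pol, Polynomial.eval_finsetSum]
  refine Finset.sum_congr rfl fun S _ => ?_
  have := (F m).map_piecewise_smul (fun _ => s) (S.piecewise b a) S
  simp only [Polynomial.eval_mul, Polynomial.eval_C, Polynomial.eval_pow, Polynomial.eval_X]
  simp only [Finset.prod_const, smul_eq_mul] at this
  rw [mul_comm, ← this]
  congr 1
  funext i
  by_cases hi : i ∈ S <;> simp [hi]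

lemma pol_deriv {m : ℕ} (a b : Fin m → Mat m) :
    (pol a b).derivative.eval 0 = ∑ i, F m (Function.update a i (b i)) := by
  have : (pol a b).derivative.eval 0 = (pol a b).coeff 1 := by
    rw [← Polynomial.coeff_zero_eq_eval_zero, Polynomial.coeff_derivative]; simp
  rw [this, pol, Polynomial.finsetSum_coeff]
  simp only [Polynomial.coeff_C_mul, Polynomial.coeff_X_pow, mul_ite, mul_one, mul_zero]
  rw [← Finset.sum_filter]
  symm
  refine Finset.sum_bij (fun i _ => {i}) ?_ ?_ ?_ ?_
  · intro i _; simp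
  · intro i _ j _ h; simpa using h
  · intro S hS
    obtain ⟨i, hi⟩ := Finset.card_eq_one.1 (Finset.mem_filter.1 hS).2.symm
    exact ⟨i, Finset.mem_univ _, hi.symm⟩
  · intro i _
    rw [Finset.piecewise_singleton]

/-- first `k` entries from `A`, the remaining are `Z`. -/
def fam {m : ℕ} (A : Fin m → Mat m) (k : ℕ) (Z : Mat m) : Fin m → Mat m :=
  fun i => if (i : ℕ) < k then A i else Z

def Up {m : ℕ} (Z : Mat m) : Prop :=
  ∃ X Y : Mat m, X.IsHermitian ∧ Y.PosDef ∧ Z = X + Complex.I • Y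

lemma Up.det_ne {m : ℕ} {Z : Mat m} (h : Up Z) : Z.det ≠ 0 := by
  obtain ⟨X, Y, hX, hY, rfl⟩ := h
  intro h0
  obtain ⟨v, hv, hv0⟩ := Matrix.exists_mulVec_eq_zero_iff.2 h0
  have h1 : star v ⬝ᵥ ((X + Complex.I • Y).mulVec v) = 0 := by rw [hv0]; simp
  rw [Matrix.add_mulVec, dotProduct_add, Matrix.smul_mulVec, dotProduct_smul] at h1
  have hx : (star v ⬝ᵥ X.mulVec v).im = 0 := hX.im_star_dotProduct_mulVec_self v
  have hy := hY.dotProduct_mulVec_pos hv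
  have hy2 := (Complex.lt_def.1 hy).1
  have := congrArg Complex.im h1
  simp [hx] at this
  simp at hy2
  linarith

lemma Up.add_smul {m : ℕ} {Z P : Mat m} (h : Up Z) (hP : P.PosDef) (s : ℂ) (hs : 0 ≤ s.im) :
    Up (Z + s • P) := by
  obtain ⟨X, Y, hX, hY, rfl⟩ := h
  refine ⟨X + s.re • P, Y + s.im • P, hX.add ?_, hY.add_posSemidef ?_, ?_⟩
  · exact hP.1.smul (by simp [IsSelfAdjoint])
  · exact hP.posSemidef.smul hs
  · ext i j
    simp only [Matrix.add_apply, Matrix.smul_apply, smul_eq_mul, Complex.real_smul]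
    conv_lhs => rw [← Complex.re_add_im s]
    ring

lemma fam_ne {m : ℕ} (A : Fin m → Mat m) (hA : ∀ i, (A i).PosDef) (k : ℕ) (hk : k ≤ m) :
    ∀ Z : Mat m, Up Z → F m (fam A k Z) ≠ 0 := by
  induction k with
  | zero =>
    intro Z hZ
    have : fam A 0 Z = fun _ => Z := by funext i; simp [fam]
    rw [this, F_const]
    exact mul_ne_zero (by exact_mod_cast m.factorial_ne_zero) hZ.det_ne
  | succ k ih =>
    intro Z hZ
    have ih := ih (by omega)
    set P := A ⟨k, by omega⟩ with hP
    have hPd : P.PosDef := hA _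
    set b : Fin m → Mat m := fun i => if (i : ℕ) < k then 0 else P with hb
    set a := fam A k Z with ha
    have heval : ∀ s, (pol a b).eval s = F m (fam A k (Z + s • P)) := by
      intro s
      rw [pol_eval]
      congr 1
      funext i
      by_cases hi : (i : ℕ) < k <;> simp [ha, hb, fam, hi]
    have hroot : ∀ s : ℂ, 0 ≤ s.im → (pol a b).eval s ≠ 0 := by
      intro s hs
      rw [heval]
      exact ih _ (hZ.add_smul hPd s hs)
    have hder : (pol a b).derivative.eval 0 = ((m - k : ℕ) : ℂ) * F m (fam A (k+1) Z) := by
      rw [pol_deriv]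
      have h1 : ∀ i : Fin m, F m (Function.update a i (b i)) =
          if (i : ℕ) < k then 0 else F m (fam A (k+1) Z) := by
        intro i
        by_cases hi : (i : ℕ) < k
        · simp only [hi, if_true, hb]
          exact (F m).map_update_zero a i
        · simp only [hi, if_false, hb]
          rw [← F_perm (fam A (k+1) Z) (Equiv.swap i ⟨k, by omega⟩)]
          congr 1
          funext j
          by_cases hji : j = i
          · subst hji; simp [fam, hP]
          · rw [Function.update_of_ne hji]
            by_cases hjk : j = ⟨k, by omega⟩
            · subst hjk
              have : ¬ ((i : ℕ) < k + 1) := by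
                intro h; apply hji; ext; simp; omega
              simp [ha, fam, this]
            · rw [Equiv.swap_apply_of_ne_of_ne hji hjk]
              have : (j : ℕ) ≠ k := fun h => hjk (Fin.ext h)
              have h2 : (j : ℕ) < k + 1 ↔ (j : ℕ) < k := by omega
              simp [ha, fam, h2]
      simp only [h1]
      rw [Finset.sum_ite, Finset.sum_const_zero, zero_add, Finset.sum_const, nsmul_eq_mul]
      congr 2
      have : (Finset.univ.filter fun i : Fin m => ¬ (i : ℕ) < k).card
        = Fintype.card (Fin m) - (Finset.univ.filter fun i : Fin m => (i : ℕ) < k).card := by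
        rw [← Finset.compl_filter, Finset.card_compl]
      rw [this, Fintype.card_fin, Fin.card_filter_val_lt]
      omega
    set T : Finset (Fin m) := Finset.univ.filter fun i : Fin m => ¬ (i : ℕ) < k with hT
    have hTpos : 0 < T.card := Finset.card_pos.2 ⟨⟨k, by omega⟩, by simp [hT]⟩
    have hcoef : (pol a b).coeff T.card = F m (fam A k P) := by
      rw [pol, Polynomial.finsetSum_coeff, Finset.sum_eq_single T]
      · simp only [Polynomial.coeff_C_mul, Polynomial.coeff_X_pow, if_true, mul_one]
        congr 1
        funext i
        by_cases hi : (i : ℕ) < k <;> simp [Finset.piecewise, hT, ha, hb, fam, hi]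
      · intro S _ hS
        simp only [Polynomial.coeff_C_mul, Polynomial.coeff_X_pow]
        split_ifs with hc
        · have : ∃ i ∈ S, i ∉ T := by
            by_contra hcon
            push Not at hcon
            exact hS (Finset.eq_of_subset_of_card_le hcon hc.le)
          obtain ⟨i, hiS, hiT⟩ := this
          rw [(F m).map_coord_zero i, zero_mul]
          have : (i : ℕ) < k := by simpa [hT] using hiT
          simp [hiS, hb, this]
        · simp
      · simp
    have hlead : F m (fam A k P) ≠ 0 := by
      have h1 := ih (Complex.I • P) ⟨0, P, Matrix.isHermitian_zero, hPd, by simp⟩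
      intro h0
      apply h1
      have := (F m).map_piecewise_smul (fun _ => Complex.I) (fam A k P) T
      rw [h0, smul_zero] at this
      rw [← this]
      congr 1
      funext i
      by_cases hi : (i : ℕ) < k <;> simp [Finset.piecewise, hT, fam, hi]
    have hd0 : (pol a b).derivative ≠ 0 := by
      intro h0
      have hc := congrArg (fun q => Polynomial.coeff q (T.card - 1)) h0
      simp only [Polynomial.coeff_derivative, Polynomial.coeff_zero] at hc
      rw [Nat.sub_add_cancel hTpos, hcoef] at hc
      rcases mul_eq_zero.1 hc with h | h
      · exact hlead h
      · exact Nat.cast_add_one_ne_zero _ h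
    intro hF
    rw [hF, mul_zero] at hder
    have hsub := Polynomial.rootSet_derivative_subset_convexHull_rootSet (P := pol a b)
    have hmem : (0:ℂ) ∈ (pol a b).derivative.rootSet ℂ := by
      rw [Polynomial.mem_rootSet]
      exact ⟨hd0, by simpa using hder⟩
    have hdeg : 0 < (pol a b).degree := by
      by_contra hcon
      rw [Polynomial.eq_C_of_degree_le_zero (not_lt.1 hcon), Polynomial.derivative_C] at hd0
      exact hd0 rfl
    have h0 := hsub hdeg hmem
    have hconv : Convex ℝ {z : ℂ | z.im < 0} := convex_halfSpace_im_lt 0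
    have : convexHull ℝ ((pol a b).rootSet ℂ) ⊆ {z : ℂ | z.im < 0} := by
      refine convexHull_min ?_ hconv
      intro z hz
      rw [Polynomial.mem_rootSet] at hz
      by_contra hcon
      simp only [Set.mem_ofPred_eq, not_lt] at hcon
      exact hroot z hcon (by simpa using hz.2)
    have := this h0
    simp at this

noncomputable def Q {n : ℕ} (A : Fin n → Mat (n+2)) (X Y : Mat (n+2)) : ℂ :=
  F (n+2) (Fin.snoc (Fin.snoc A X : Fin (n+1) → Mat (n+2)) Y : Fin (n+2) → Mat (n+2))

lemma snoc2_cases {n : ℕ} {p : Fin (n+2) → Prop} (h : ∀ i : Fin n, p i.castSucc.castSucc)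
    (h1 : p (Fin.last n).castSucc) (h2 : p (Fin.last (n+1))) : ∀ i, p i := by
  intro i
  refine Fin.lastCases h2 (fun i => ?_) i
  exact Fin.lastCases h1 (fun i => h i) i

lemma Q_add {n : ℕ} (A : Fin n → Mat (n+2)) (X Y Z : Mat (n+2)) :
    Q A X (Y + Z) = Q A X Y + Q A X Z := by
  unfold Q
  have := (F (n+2)).map_update_add
    (Fin.snoc (Fin.snoc A X : Fin (n+1) → Mat (n+2)) 0 : Fin (n+2) → Mat (n+2)) (Fin.last _) Y Z
  simpa only [Fin.update_snoc_last] using this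

lemma Q_smul {n : ℕ} (A : Fin n → Mat (n+2)) (X Y : Mat (n+2)) (c : ℂ) :
    Q A X (c • Y) = c * Q A X Y := by
  unfold Q
  have := (F (n+2)).map_update_smul
    (Fin.snoc (Fin.snoc A X : Fin (n+1) → Mat (n+2)) 0 : Fin (n+2) → Mat (n+2)) (Fin.last _) c Y
  simpa only [Fin.update_snoc_last, smul_eq_mul] using this

lemma Q_symm {n : ℕ} (A : Fin n → Mat (n+2)) (X Y : Mat (n+2)) :
    Q A X Y = Q A Y X := by
  unfold Q
  rw [← F_perm _ (Equiv.swap (Fin.last (n+1)) (Fin.last n).castSucc)]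
  congr 1
  funext i
  revert i
  apply snoc2_cases
  · intro i
    rw [Equiv.swap_apply_of_ne_of_ne]
    · simp only [Fin.snoc_castSucc]
    · exact Fin.castSucc_ne_last _
    · intro h
      exact Fin.castSucc_ne_last _ (Fin.castSucc_injective _ h)
  · simp only [Equiv.swap_apply_right, Fin.snoc_castSucc, Fin.snoc_last]
  · simp only [Equiv.swap_apply_left, Fin.snoc_castSucc, Fin.snoc_last]

lemma md_real {n : ℕ} (A : Fin n → Mat (n+2)) (hA : ∀ i, (A i).IsHermitian) (X Y : Mat (n+2))
    (hX : X.IsHermitian) (hY : Y.IsHermitian) :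
    Q A X Y = ((n+2).factorial : ℂ) * (mixedDisc2 A X Y : ℝ) := by
  have hc : (starRingEnd ℂ) (Q A X Y) = Q A X Y := by
    apply F_conj
    apply snoc2_cases
    · intro i; simpa only [Fin.snoc_castSucc] using hA i
    · simpa only [Fin.snoc_castSucc, Fin.snoc_last] using hX
    · simpa only [Fin.snoc_last] using hY
  have h0 : (((n+2).factorial : ℕ) : ℂ) ≠ 0 := by exact_mod_cast (n+2).factorial_ne_zero
  have h1 : mixedDisc2 A X Y = ((((n+2).factorial : ℕ) : ℂ)⁻¹ * Q A X Y).re := by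
    unfold mixedDisc2 mixedDisc Q
    rw [F_apply]
  have h2 : (((mixedDisc2 A X Y : ℝ)) : ℂ) = (((n+2).factorial : ℕ) : ℂ)⁻¹ * Q A X Y := by
    rw [h1]
    apply Complex.conj_eq_iff_re.1
    simp [hc]
  rw [h2, mul_inv_cancel_left₀ h0]

lemma md_re {n : ℕ} (A : Fin n → Mat (n+2)) (hA : ∀ i, (A i).IsHermitian) (X Y : Mat (n+2))
    (hX : X.IsHermitian) (hY : Y.IsHermitian) :
    Q A X Y = ((Q A X Y).re : ℂ) := by
  rw [md_real A hA X Y hX hY]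
  rw [← Complex.ofReal_natCast, ← Complex.ofReal_mul, Complex.ofReal_re]

lemma alex_pd {n : ℕ} (A : Fin n → Mat (n+2)) (hA : ∀ i, (A i).PosDef) (P X : Mat (n+2))
    (hP : P.PosDef) (hX : X.IsHermitian) :
    (Q A P P).re * (Q A X X).re ≤ (Q A P X).re ^ 2 := by
  by_contra hcon
  push Not at hcon
  have hA' := fun i => (hA i).1
  have hPP := md_re A hA' P P hP.1 hP.1
  have hPX := md_re A hA' P X hP.1 hX
  have hXX := md_re A hA' X X hX hX
  set α := (Q A P P).re
  set β := (Q A P X).re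
  set γ := (Q A X X).re
  have hα : α ≠ 0 := by
    intro h; rw [h] at hcon; nlinarith [sq_nonneg β]
  have hnz : ∀ t : ℂ, 0 < t.im → (α : ℂ) * t^2 + 2 * β * t + γ ≠ 0 := by
    intro t ht
    set Z := X + t • P with hZ
    have hU : Up Z := by
      refine ⟨X + t.re • P, t.im • P, hX.add (hP.1.smul (by simp [IsSelfAdjoint])),
        hP.smul ht, ?_⟩
      ext i j
      simp only [hZ, Matrix.add_apply, Matrix.smul_apply, smul_eq_mul, Complex.real_smul]
      conv_lhs => rw [← Complex.re_add_im t]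
      ring
    have h := fam_ne (Fin.snoc (Fin.snoc A P : Fin (n+1) → Mat (n+2)) P : Fin (n+2) → Mat (n+2))
      (by
        apply snoc2_cases
        · intro i; simpa only [Fin.snoc_castSucc] using hA i
        · simpa only [Fin.snoc_castSucc, Fin.snoc_last] using hP
        · simpa only [Fin.snoc_last] using hP) n (by omega) Z hU
    have h2 : F (n+2) (fam (Fin.snoc (Fin.snoc A P : Fin (n+1) → Mat (n+2)) P :
        Fin (n+2) → Mat (n+2)) n Z) = Q A Z Z := by
      unfold Q
      congr 1
      funext i
      revert i
      apply snoc2_cases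
      · intro i; simp only [fam, Fin.snoc_castSucc]; simp
      · simp only [fam, Fin.snoc_castSucc, Fin.snoc_last]; simp
      · simp only [fam, Fin.snoc_last]; simp
    rw [h2] at h
    have h3 : Q A Z Z = (α : ℂ) * t^2 + 2 * β * t + γ := by
      rw [← hPP, ← hPX, ← hXX, hZ, Q_add, Q_smul, Q_symm A _ X, Q_symm A _ P, Q_add, Q_add,
        Q_smul, Q_smul, Q_symm A X P]
      ring
    rwa [← h3]
  set d := Real.sqrt (α * γ - β^2)
  have hd : 0 < d := Real.sqrt_pos.2 (by linarith)
  have hd2 : d^2 = α * γ - β^2 := Real.sq_sqrt (by linarith)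
  apply hnz ((-β/α : ℝ) + (d/|α| : ℝ) * Complex.I)
  · have h : 0 < d / |α| := by positivity
    rw [Complex.add_im, Complex.ofReal_im, Complex.mul_im]
    simp [-Complex.ofReal_div, h]
  · have e : (d/|α|)^2 = (α * γ - β^2)/α^2 := by rw [div_pow, hd2, sq_abs]
    have e1 : α * ((-β/α)^2 - (d/|α|)^2) + 2 * β * (-β/α) + γ = 0 := by
      rw [e]; field_simp; ring
    have e2 : α * (2 * (-β/α)) + 2 * β = 0 := by field_simp; ring
    set u := -β/α
    set w := d/|α|
    have e1' : (α:ℂ) * ((u:ℂ)^2 - (w:ℂ)^2) + 2 * β * u + γ = 0 := by exact_mod_cast e1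
    have e2' : (α:ℂ) * (2 * u) + 2 * β = 0 := by exact_mod_cast e2
    linear_combination e1' + w * Complex.I * e2' + α * w^2 * Complex.I_sq

lemma Q_cont {n : ℕ} (A B : Fin n → Mat (n+2)) (X X' Y Y' : Mat (n+2)) :
    Continuous fun s : ℝ => (Q (fun i => A i + (s:ℂ) • B i) (X + (s:ℂ) • X') (Y + (s:ℂ) • Y')).re := by
  have : ∀ s : ℝ, Q (fun i => A i + (s:ℂ) • B i) (X + (s:ℂ) • X') (Y + (s:ℂ) • Y') =
    (pol (Fin.snoc (Fin.snoc A X : Fin (n+1) → Mat (n+2)) Y : Fin (n+2) → Mat (n+2))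
     (Fin.snoc (Fin.snoc B X' : Fin (n+1) → Mat (n+2)) Y' : Fin (n+2) → Mat (n+2))).eval (s:ℂ) := by
    intro s
    rw [pol_eval]
    unfold Q
    congr 1
    funext i
    revert i
    apply snoc2_cases
    · intro i; simp only [Fin.snoc_castSucc]
    · simp only [Fin.snoc_castSucc, Fin.snoc_last]
    · simp only [Fin.snoc_last]
  simp only [this]
  exact Complex.continuous_re.comp ((Polynomial.continuous _).comp Complex.continuous_ofReal)

lemma alex {n : ℕ} (A : Fin n → Mat (n+2)) (hA : ∀ i, (A i).PosSemidef) (P X : Mat (n+2))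
    (hP : P.PosSemidef) (hX : X.IsHermitian) :
    (Q A P P).re * (Q A X X).re ≤ (Q A P X).re ^ 2 := by
  have c1 := Q_cont A (fun _ => 1) P 1 P 1
  have c2 := Q_cont A (fun _ => 1) X 0 X 0
  have c3 := Q_cont A (fun _ => 1) P 1 X 0
  have t1 := (((c1.mul c2).tendsto 0).mono_left (nhdsWithin_le_nhds (s := Set.Ioi 0)))
  have t2 := (((c3.pow 2).tendsto 0).mono_left (nhdsWithin_le_nhds (s := Set.Ioi 0)))
  have := le_of_tendsto_of_tendsto t1 t2 (by
    filter_upwards [self_mem_nhdsWithin] with s hs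
    have hs : 0 < s := hs
    have hpd : ∀ M : Mat (n+2), M.PosSemidef → (M + (s:ℂ) • (1 : Mat (n+2))).PosDef := by
      intro M hM
      exact Matrix.PosDef.posSemidef_add hM (Matrix.PosDef.one.smul (by exact_mod_cast hs))
    have h := alex_pd (fun i => A i + (s:ℂ) • 1) (fun i => hpd _ (hA i)) (P + (s:ℂ) • 1) X
      (hpd _ hP) hX
    simpa using h)
  simpa using this

end MixedAux

open MixedAux

theorem stmt11 {n : ℕ} (A : Fin n → Matrix (Fin (n + 2)) (Fin (n + 2)) ℂ)
    (hA : ∀ i, (A i).PosSemidef)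
    (A' : Matrix (Fin (n + 2)) (Fin (n + 2)) ℂ) (hA' : A'.PosSemidef)
    (hAA : mixedDisc2 A A' A' ≠ 0)
    (B : Matrix (Fin (n + 2)) (Fin (n + 2)) ℂ) (hB : B.IsHermitian)
    (hAB : mixedDisc2 A A' B = 0) (hBB : mixedDisc2 A B B = 0) :
    ∀ C : Matrix (Fin (n + 2)) (Fin (n + 2)) ℂ, C.IsHermitian →
      mixedDisc2 A B C = 0 := by
  intro C hC
  have hAh := fun i => (hA i).1
  have hf : (((n+2).factorial : ℕ) : ℂ) ≠ 0 := by exact_mod_cast (n+2).factorial_ne_zero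
  have qAB : Q A A' B = 0 := by rw [md_real A hAh _ _ hA'.1 hB, hAB]; simp
  have qBB : Q A B B = 0 := by rw [md_real A hAh _ _ hB hB, hBB]; simp
  have rAA := md_re A hAh _ _ hA'.1 hA'.1
  have rAC := md_re A hAh _ _ hA'.1 hC
  have rBC := md_re A hAh _ _ hB hC
  have rCC := md_re A hAh _ _ hC hC
  set a := (Q A A' A').re
  set c := (Q A A' C).re
  set x := (Q A B C).re with hx
  set y := (Q A C C).re
  have ha : a ≠ 0 := by
    intro h
    rw [h, md_real A hAh _ _ hA'.1 hA'.1] at rAA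
    simp [hf, hAA] at rAA
  have key : ∀ s : ℝ, a * (2 * s * x + s^2 * (y - c^2/a)) ≤ 0 := by
    intro s
    set t : ℝ := -(s * c / a)
    have hH : (B + ((s:ℂ) • C + (t:ℂ) • A')).IsHermitian :=
      hB.add ((hC.smul (by simp [IsSelfAdjoint])).add (hA'.1.smul (by simp [IsSelfAdjoint])))
    have h := alex A hA A' _ hA' hH
    have e1 : Q A A' (B + ((s:ℂ) • C + (t:ℂ) • A')) = ((s * c + t * a : ℝ) : ℂ) := by
      rw [Q_add, Q_add, Q_smul, Q_smul, qAB, rAC, rAA]; push_cast; ring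
    have e1' : s * c + t * a = 0 := by simp only [t]; field_simp; ring
    have eC : Q A C (B + ((s:ℂ) • C + (t:ℂ) • A')) = ((x + s * y + t * c : ℝ) : ℂ) := by
      rw [Q_add, Q_add, Q_smul, Q_smul, Q_symm A C B, Q_symm A C A', rAC, rBC, rCC]
      push_cast; ring
    have eB : Q A B (B + ((s:ℂ) • C + (t:ℂ) • A')) = ((s * x : ℝ) : ℂ) := by
      rw [Q_add, Q_add, Q_smul, Q_smul, Q_symm A B A', qAB, qBB, rBC]
      push_cast; ring
    have e2 : Q A (B + ((s:ℂ) • C + (t:ℂ) • A')) (B + ((s:ℂ) • C + (t:ℂ) • A')) =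
        ((s * x + s * (x + s * y + t * c) : ℝ) : ℂ) := by
      rw [Q_add, Q_add, Q_smul, Q_smul, Q_symm A _ B, Q_symm A _ C, Q_symm A _ A', e1, e1', eB, eC]
      push_cast; ring
    rw [e1, e2, e1', Complex.ofReal_re, Complex.ofReal_re] at h
    have e3 : s * x + s * (x + s * y + t * c) = 2 * s * x + s^2 * (y - c^2/a) := by
      simp only [t]; field_simp; ring
    rw [e3] at h
    simpa [a] using h
  have hx0 : x = 0 := by
    have hax : a * x = 0 := by
      set p := a * x with hp
      set q := a * (y - c^2/a) with hq
      have k2 : ∀ s : ℝ, 2 * s * p + s^2 * q ≤ 0 := by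
        intro s; have := key s; rw [hp, hq]; linarith
      by_contra hne
      have hp2 : 0 < p^2 := by positivity
      have hD : 0 < |q| + 1 := by positivity
      have h := k2 (p / (|q| + 1))
      have h4 : 2 * (p / (|q| + 1)) * p + (p / (|q| + 1))^2 * q
          = p^2 * (2 * (|q| + 1) + q) / (|q|+1)^2 := by field_simp
      rw [h4] at h
      have h5 : 0 < 2 * (|q| + 1) + q := by linarith [neg_abs_le q, abs_nonneg q]
      have : 0 < p^2 * (2 * (|q| + 1) + q) / (|q|+1)^2 := by positivity
      linarith
    exact (mul_eq_zero.1 hax).resolve_left ha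
  have := md_real A hAh _ _ hB hC
  rw [rBC, hx0] at this
  have h6 := (mul_eq_zero.1 (this.symm.trans Complex.ofReal_zero)).resolve_left hf
  exact_mod_cast h6
end

section
/- Let ω₁, …, ω_{n-2} be positive definite n×n Hermitian matrices. Then the linear map sending a Hermitian matrix X to the functional D(ω₁,…,ω_{n-2},X,·) on Hermitian matrices is injective; i.e. if D(ω₁,…,ω_{n-2},X,Y) = 0 for all Hermitian Y, then X = 0. -/
open scoped ComplexOrder

namespace MD
open Matrix

abbrev Mat (m : ℕ) := Matrix (Fin m) (Fin m) ℂ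

theorem perm {m : ℕ} (A : Fin m → Mat m) (π : Equiv.Perm (Fin m)) :
    mixedDisc (fun k => A (π k)) = mixedDisc A := by
  unfold mixedDisc
  congr 2
  exact Equiv.sum_comp (Equiv.mulLeft π) (fun σ => (Matrix.of fun i j => A (σ j) i j).det)

theorem upd_eq {m : ℕ} (A : Fin m → Mat (m+1)) (Y : Mat (m+1)) (σ : Equiv.Perm (Fin (m+1))) :
    (Matrix.of fun i j => (Fin.snoc A Y : Fin (m+1) → Mat (m+1)) (σ j) i j) =
    (Matrix.of fun i j => (Fin.snoc A 0 : Fin (m+1) → Mat (m+1)) (σ j) i j).updateCol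
      (σ.symm (Fin.last m)) (fun i => Y i (σ.symm (Fin.last m))) := by
  ext i j
  by_cases h : j = σ.symm (Fin.last m)
  · subst h; simp
  · rw [updateCol_ne h]
    have h2 : σ j ≠ Fin.last m := fun e => h (by rw [← e]; simp)
    obtain ⟨k, hk⟩ := Fin.exists_castSucc_eq.mpr h2
    simp [← hk]

theorem snoc_add {m : ℕ} (A : Fin m → Mat (m+1)) (Y Z : Mat (m+1)) :
    mixedDisc (Fin.snoc A (Y + Z)) = mixedDisc (Fin.snoc A Y) + mixedDisc (Fin.snoc A Z) := by
  unfold mixedDisc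
  rw [← Complex.add_re, ← mul_add, ← Finset.sum_add_distrib]
  congr 3
  ext σ
  rw [upd_eq A (Y+Z), upd_eq A Y, upd_eq A Z, ← det_updateCol_add]
  rfl

theorem snoc_smul {m : ℕ} (A : Fin m → Mat (m+1)) (c : ℝ) (Y : Mat (m+1)) :
    mixedDisc (Fin.snoc A (c • Y)) = c * mixedDisc (Fin.snoc A Y) := by
  unfold mixedDisc
  rw [← Complex.re_ofReal_mul, mul_left_comm, Finset.mul_sum _ _ (c : ℂ)]
  congr 2
  refine Finset.sum_congr rfl fun σ _ => ?_
  rw [upd_eq A (c • Y), upd_eq A Y, ← det_updateCol_smul]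
  rfl

noncomputable def lin {m : ℕ} (A : Fin m → Mat (m+1)) : Mat (m+1) →ₗ[ℝ] ℝ where
  toFun Y := mixedDisc (Fin.snoc A Y)
  map_add' := snoc_add A
  map_smul' c Y := snoc_smul A c Y

theorem row_form {m : ℕ} (A : Fin m → Mat m) :
    ∑ σ : Equiv.Perm (Fin m), (Matrix.of fun i j => A (σ j) i j).det =
    ∑ σ : Equiv.Perm (Fin m), (Matrix.of fun i j => A (σ i) i j).det := by
  simp_rw [det_apply]
  rw [Finset.sum_comm]
  conv_rhs => rw [Finset.sum_comm]
  refine Finset.sum_congr rfl fun τ _ => ?_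
  rw [← Equiv.sum_comp (Equiv.mulRight τ)]
  refine Finset.sum_congr rfl fun σ _ => ?_
  simp

theorem conj {m : ℕ} (A : Fin m → Mat m) (C : Mat m) :
    mixedDisc (fun k => C * A k * Cᴴ) = Complex.normSq C.det * mixedDisc A := by
  have h : ∑ σ : Equiv.Perm (Fin m), (Matrix.of fun i j => (C * A (σ j) * Cᴴ) i j).det
     = (Complex.normSq C.det : ℂ) * ∑ σ : Equiv.Perm (Fin m), (Matrix.of fun i j => A (σ j) i j).det := by
    have h1 : ∀ σ : Equiv.Perm (Fin m), (Matrix.of fun i j => (C * A (σ j) * Cᴴ) i j)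
      = C * (Matrix.of fun i j => (A (σ j) * Cᴴ) i j) := by
      intro σ; ext i j; simp only [of_apply, Matrix.mul_assoc]; simp [Matrix.mul_apply (M := C)]
    have h2 : ∀ σ : Equiv.Perm (Fin m), (Matrix.of fun i j => (A (σ i) * Cᴴ) i j)
      = (Matrix.of fun i j => A (σ i) i j) * Cᴴ := by
      intro σ; ext i j; simp [Matrix.mul_apply]
    simp_rw [h1, det_mul, ← Finset.mul_sum]
    rw [row_form (fun k => A k * Cᴴ), row_form A]
    simp_rw [h2, det_mul, ← Finset.sum_mul, det_conjTranspose]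
    rw [Complex.normSq_eq_conj_mul_self]
    simp only [RCLike.star_def]; ring
  unfold mixedDisc
  rw [h, ← Complex.re_ofReal_mul, mul_left_comm]

def del {m : ℕ} (p : Fin (m+1)) (A : Mat (m+1)) : Mat m := A.submatrix p.succAbove p.succAbove

theorem snoc_single {m : ℕ} (A : Fin m → Mat (m+1)) (p : Fin (m+1)) :
    mixedDisc (Fin.snoc A (Matrix.single p p 1)) =
      ((m:ℝ)+1)⁻¹ * mixedDisc (fun k => del p (A k)) := by
  have h : ∑ σ : Equiv.Perm (Fin (m+1)), (Matrix.of fun i j =>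
      (Fin.snoc A (Matrix.single p p 1) : Fin (m+1) → Mat (m+1)) (σ j) i j).det =
      ∑ τ : Equiv.Perm (Fin m), (Matrix.of fun i j => del p (A (τ j)) i j).det := by
    let e : Equiv.Perm (Option (Fin m)) ≃ Equiv.Perm (Fin (m+1)) :=
      Equiv.equivCongr (finSuccEquiv' p).symm (finSuccEquiv' (Fin.last m)).symm
    have e1 : ∀ ρ, e ρ p = (finSuccEquiv' (Fin.last m)).symm (ρ none) := by
      intro ρ; simp [e]
    have e2 : ∀ ρ j, e ρ (p.succAbove j) = (finSuccEquiv' (Fin.last m)).symm (ρ (some j)) := by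
      intro ρ; simp [e]
    rw [← Equiv.sum_comp e, ← Equiv.sum_comp (Equiv.Perm.decomposeOption).symm,
      Fintype.sum_prod_type, Fintype.sum_option]
    rw [Finset.sum_eq_zero (s := (Finset.univ : Finset (Fin m))), add_zero]
    · refine Finset.sum_congr rfl fun τ _ => ?_
      rw [det_succ_column _ p, Finset.sum_eq_single p]
      · simp only [of_apply, e1]
        simp [← two_mul, pow_mul]
        congr 1
        ext i j
        simp [e2, del]
      · intro b _ hb
        simp [e1, Matrix.single_apply, hb.symm]
      · simp
    · intro o _
      refine Finset.sum_eq_zero fun τ _ => ?_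
      set σ := e (Equiv.Perm.decomposeOption.symm (some o, τ)) with hσ
      have hp : σ p ≠ Fin.last m := by
        rw [hσ, e1]; simp
      have hp2 : p ≠ σ.symm (Fin.last m) := fun h => hp (by rw [h]; simp)
      refine det_eq_zero_of_column_eq_zero (σ.symm (Fin.last m)) fun i => ?_
      simp [Matrix.single_apply, hp2]
  unfold mixedDisc
  rw [h, ← Complex.re_ofReal_mul, ← mul_assoc]
  congr 2
  push_cast [Nat.factorial_succ]
  rw [mul_inv]

theorem snoc_one {m : ℕ} (A : Fin m → Mat (m+1)) :
    mixedDisc (Fin.snoc A 1) = ((m:ℝ)+1)⁻¹ * ∑ p, mixedDisc (fun k => del p (A k)) := by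
  have : (1 : Mat (m+1)) = ∑ p, Matrix.single p p 1 := by
    ext i j
    simp [Matrix.sum_apply, Matrix.single_apply, Matrix.one_apply, ite_and]
  change lin A 1 = _
  rw [this, map_sum, Finset.mul_sum]
  exact Finset.sum_congr rfl fun p _ => snoc_single A p

theorem cont {m : ℕ} : Continuous (fun A : Fin m → Mat m => mixedDisc A) := by
  unfold mixedDisc
  refine Complex.continuous_re.comp (continuous_const.mul (continuous_finsetSum _ fun σ _ => ?_))
  refine Continuous.matrix_det ?_
  fun_prop

theorem exists_conj {m : ℕ} (B : Mat m) (hB : B.PosDef) : ∃ C : Mat m, IsUnit C.det ∧ C * B * Cᴴ = 1 := by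
  open scoped MatrixOrder in
  have h0 : 0 ≤ B := Matrix.nonneg_iff_posSemidef.2 hB.posSemidef
  open scoped MatrixOrder Matrix.Norms.L2Operator in
  obtain ⟨F, h⟩ := CStarAlgebra.nonneg_iff_eq_star_mul_self.1 h0
  rw [Matrix.star_eq_conjTranspose] at h
  have hd : IsUnit B.det := (Matrix.isUnit_iff_isUnit_det _).1 hB.isUnit
  have hF : IsUnit F.det := by
    rw [h, det_mul] at hd
    exact isUnit_of_mul_isUnit_right hd
  have hF2 : IsUnit Fᴴ.det := by
    rw [h, det_mul] at hd
    exact isUnit_of_mul_isUnit_left hd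
  refine ⟨(Fᴴ)⁻¹, ?_, ?_⟩
  · exact Matrix.isUnit_nonsing_inv_det _ hF2
  · rw [h, Matrix.conjTranspose_nonsing_inv, conjTranspose_conjTranspose,
      Matrix.nonsing_inv_mul_cancel_left _ _ hF2, Matrix.mul_nonsing_inv _ hF]

theorem del_posDef {m : ℕ} (p : Fin (m+1)) {A : Mat (m+1)} (hA : A.PosDef) : (del p A).PosDef :=
  hA.submatrix (Fin.succAbove_right_injective)

theorem conj_posDef {m : ℕ} {A : Mat m} (hA : A.PosDef) {C : Mat m} (hC : IsUnit C.det) :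
   (C * A * Cᴴ).PosDef :=
  hA.mul_mul_conjTranspose_same (Matrix.vecMul_injective_of_isUnit ((Matrix.isUnit_iff_isUnit_det _).2 hC))

theorem md_pos {m : ℕ} (A : Fin m → Mat m) (hA : ∀ i, (A i).PosDef) : 0 < mixedDisc A := by
  induction m with
  | zero => simp [mixedDisc]
  | succ m ih =>
    obtain ⟨C, hC, h1⟩ := exists_conj _ (hA (Fin.last m))
    have h := conj A C
    have h2 : (fun k => C * A k * Cᴴ) = Fin.snoc (fun k : Fin m => C * A k.castSucc * Cᴴ) 1 := by
      ext k
      refine Fin.lastCases ?_ (fun k => ?_) k <;> simp [h1]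
    rw [h2, snoc_one] at h
    have h3 : 0 < ((m:ℝ)+1)⁻¹ * ∑ p, mixedDisc (fun k : Fin m => del p (C * A k.castSucc * Cᴴ)) := by
      refine mul_pos (by positivity) (Finset.sum_pos (fun p _ => ih _ fun k => ?_) ⟨0, Finset.mem_univ _⟩)
      exact del_posDef p (conj_posDef (hA _) hC)
    rw [h] at h3
    exact pos_of_mul_pos_right h3 (Complex.normSq_nonneg _)

theorem md2_symm {n : ℕ} (A : Fin n → Mat (n+2)) (X Y : Mat (n+2)) :
    mixedDisc2 A X Y = mixedDisc2 A Y X := by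
  unfold mixedDisc2
  rw [← perm _ (Equiv.swap (Fin.last (n+1)) (Fin.last n).castSucc)]
  congr 1
  ext k : 1
  refine Fin.lastCases ?_ (fun k => ?_) k
  · simp
  · refine Fin.lastCases ?_ (fun k => ?_) k
    · simp
    · rw [Equiv.swap_apply_of_ne_of_ne] <;> simp [Fin.ext_iff, k.2.ne, (k.2.trans (Nat.lt_succ_self _)).ne]

theorem md3_symm {n : ℕ} (A : Fin n → Mat (n+3)) (W X Y : Mat (n+3)) :
    mixedDisc (Fin.snoc (Fin.snoc (Fin.snoc A W) X) Y : Fin (n+3) → Mat (n+3))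
      = mixedDisc (Fin.snoc (Fin.snoc (Fin.snoc A Y) X) W : Fin (n+3) → Mat (n+3)) := by
  rw [← perm _ (Equiv.swap (Fin.last (n+2)) (Fin.last n).castSucc.castSucc)]
  congr 1
  ext k : 1
  refine Fin.lastCases ?_ (fun k => ?_) k
  · simp
  · refine Fin.lastCases ?_ (fun k => ?_) k
    · rw [Equiv.swap_apply_of_ne_of_ne] <;> simp [Fin.ext_iff]
    · refine Fin.lastCases ?_ (fun k => ?_) k
      · simp
      · rw [Equiv.swap_apply_of_ne_of_ne] <;> simp [Fin.ext_iff, k.2.ne, (k.2.trans (Nat.lt_succ_self _)).ne] <;> omega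


theorem conj2 {n : ℕ} (A : Fin n → Mat (n+2)) (X Y C : Mat (n+2)) :
    mixedDisc2 (fun k => C * A k * Cᴴ) (C * X * Cᴴ) (C * Y * Cᴴ) =
      Complex.normSq C.det * mixedDisc2 A X Y := by
  unfold mixedDisc2
  rw [← conj]
  congr 1
  ext k : 1
  refine Fin.lastCases ?_ (fun k => ?_) k
  · simp
  · refine Fin.lastCases ?_ (fun k => ?_) k <;> simp

theorem del_snoc2 {n : ℕ} (A : Fin n → Mat (n+3)) (X Y : Mat (n+3)) (p : Fin (n+3)) :
    mixedDisc (fun k => del p ((Fin.snoc (Fin.snoc A X) Y : Fin (n+2) → Mat (n+3)) k)) =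
      mixedDisc2 (fun k => del p (A k)) (del p X) (del p Y) := by
  unfold mixedDisc2
  congr 1
  ext k : 1
  refine Fin.lastCases ?_ (fun k => ?_) k
  · simp
  · refine Fin.lastCases ?_ (fun k => ?_) k <;> simp

theorem md2_snoc_one {n : ℕ} (A : Fin n → Mat (n+3)) (X Y : Mat (n+3)) :
    mixedDisc2 (Fin.snoc A 1 : Fin (n+1) → Mat (n+3)) X Y =
      ((n:ℝ)+3)⁻¹ * ∑ p, mixedDisc2 (fun k => del p (A k)) (del p X) (del p Y) := by
  unfold mixedDisc2
  rw [md3_symm, snoc_one]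
  congr 1
  · push_cast; ring
  · refine Finset.sum_congr rfl fun p _ => ?_
    rw [del_snoc2, md2_symm]
    rfl

theorem md2_add {n : ℕ} (A : Fin n → Mat (n+2)) (X Y Z : Mat (n+2)) :
    mixedDisc2 A X (Y + Z) = mixedDisc2 A X Y + mixedDisc2 A X Z := snoc_add _ _ _

theorem md2_smul {n : ℕ} (A : Fin n → Mat (n+2)) (X Y : Mat (n+2)) (c : ℝ) :
    mixedDisc2 A X (c • Y) = c * mixedDisc2 A X Y := snoc_smul _ _ _

theorem md2_add_left {n : ℕ} (A : Fin n → Mat (n+2)) (X Y Z : Mat (n+2)) :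
    mixedDisc2 A (Y + Z) X = mixedDisc2 A Y X + mixedDisc2 A Z X := by
  simp only [md2_symm A _ X, md2_add]

theorem md2_smul_left {n : ℕ} (A : Fin n → Mat (n+2)) (X Y : Mat (n+2)) (c : ℝ) :
    mixedDisc2 A (c • Y) X = c * mixedDisc2 A Y X := by
  simp only [md2_symm A _ X, md2_smul]

theorem sum_del {n : ℕ} (f : Fin (n+3) → Fin (n+3) → ℂ) (hf : ∀ i, f i i = 0) :
    ∑ p, ∑ j, ∑ k, f (Fin.succAbove p j) (Fin.succAbove p k) = ((n:ℂ)+1) * ∑ j, ∑ k, f j k := by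
  have h : ∀ p : Fin (n+3), ∑ j, ∑ k, f (Fin.succAbove p j) (Fin.succAbove p k) =
      ∑ j, ∑ k, f j k - ∑ k, f p k - ∑ j, f j p := by
    intro p
    rw [Fin.sum_univ_succAbove (fun j => ∑ k, f j k) p, Fin.sum_univ_succAbove (fun j => f j p) p,
      hf]
    have : ∀ j : Fin (n+2), ∑ k, f (Fin.succAbove p j) k = f (Fin.succAbove p j) p +
        ∑ k, f (Fin.succAbove p j) (Fin.succAbove p k) := fun j => Fin.sum_univ_succAbove _ p
    simp_rw [this, Finset.sum_add_distrib]
    ring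
  simp_rw [h, Finset.sum_sub_distrib]
  rw [Finset.sum_comm (f := fun p j => f j p)]
  simp
  ring

theorem md2_ones {n : ℕ} (X Y : Mat (n+2)) :
    mixedDisc2 (fun _ : Fin n => 1) X Y =
      (((n:ℝ)+1) * ((n:ℝ)+2))⁻¹ * (∑ j, ∑ k, (X j j * Y k k - X j k * Y k j)).re := by
  induction n with
  | zero =>
    unfold mixedDisc2 mixedDisc
    rw [← Equiv.sum_comp (Equiv.Perm.decomposeFin).symm, Fintype.sum_prod_type]
    simp [Fin.sum_univ_two, det_fin_two, Fin.snoc, Equiv.Perm.decomposeFin]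
    ring
  | succ n ih =>
    have h1 : (fun _ : Fin (n+1) => (1 : Mat (n+3))) = Fin.snoc (fun _ : Fin n => (1 : Mat (n+3))) 1 := by
      ext k : 1
      refine Fin.lastCases ?_ (fun k => ?_) k <;> simp
    have h2 : ∀ p : Fin (n+3), del p 1 = 1 := fun p =>
      Matrix.submatrix_one _ Fin.succAbove_right_injective
    have h3 := sum_del (fun j k => X j j * Y k k - X j k * Y k j) (fun i => by simp)
    have h4 : ((n:ℂ)+1) = (((n:ℝ)+1 : ℝ) : ℂ) := by push_cast; rfl
    rw [h4] at h3
    have h3 := congrArg Complex.re h3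
    rw [Complex.re_ofReal_mul, Complex.re_sum] at h3
    rw [h1, md2_snoc_one]
    simp only [h2, ih]
    rw [← Finset.mul_sum]
    simp only [del, submatrix_apply]
    rw [h3]
    push_cast
    have : (n:ℝ)+1 ≠ 0 := by positivity
    have : (n:ℝ)+2 ≠ 0 := by positivity
    have : (n:ℝ)+3 ≠ 0 := by positivity
    field_simp
    ring

theorem md2_ones_one {n : ℕ} (Y : Mat (n+2)) :
    mixedDisc2 (fun _ : Fin n => 1) 1 Y = ((n:ℝ)+2)⁻¹ * (Y.trace).re := by
  rw [md2_ones]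
  have : ∑ j, ∑ k, ((1 : Mat (n+2)) j j * Y k k - (1 : Mat (n+2)) j k * Y k j) =
    (((n:ℝ)+1 : ℝ) : ℂ) * Y.trace := by
    simp [Matrix.one_apply, Matrix.trace, Finset.sum_sub_distrib]
    ring
  rw [this, Complex.re_ofReal_mul]
  have : (n:ℝ)+1 ≠ 0 := by positivity
  field_simp

theorem md2_ones_self {n : ℕ} (X : Mat (n+2)) (hX : X.IsHermitian) :
    mixedDisc2 (fun _ : Fin n => 1) X X =
      (((n:ℝ)+1) * ((n:ℝ)+2))⁻¹ * (X.trace.re ^ 2 - ∑ j, ∑ k, Complex.normSq (X j k)) := by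
  have hd : ∀ j, (X j j).im = 0 := fun j => by
    have := congrArg Complex.im (hX.apply j j)
    simp at this
    linarith
  have ho : ∀ j k, X j k * X k j = (Complex.normSq (X j k) : ℂ) := fun j k => by
    rw [← hX.apply k j, Complex.normSq_eq_conj_mul_self]
    simp [mul_comm]
  rw [md2_ones]
  congr 1
  simp_rw [Finset.sum_sub_distrib, ← Finset.mul_sum, ← Finset.sum_mul, ho, Complex.sub_re]
  congr 1
  · change (X.trace * X.trace).re = _
    have : X.trace.im = 0 := by simp [Matrix.trace, hd]
    simp [Complex.mul_re, this]; ring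
  · simp

/-- the modified quadratic form -/
noncomputable def S {n : ℕ} (A : Fin n → Mat (n+2)) (B X : Mat (n+2)) : ℝ :=
  2 * (mixedDisc2 A B X)^2 - mixedDisc2 A B B * mixedDisc2 A X X

theorem S_ones {n : ℕ} (X : Mat (n+2)) (hX : X.IsHermitian) (h0 : X ≠ 0) :
    0 < S (fun _ => 1) 1 X := by
  have hpos : 0 < ∑ j, ∑ k, Complex.normSq (X j k) := by
    by_contra hcon
    apply h0
    have h1 : ∑ j, ∑ k, Complex.normSq (X j k) = 0 := le_antisymm (not_lt.1 hcon)
      (Finset.sum_nonneg fun j _ => Finset.sum_nonneg fun k _ => Complex.normSq_nonneg _)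
    ext j k
    have h3 := (Finset.sum_eq_zero_iff_of_nonneg
      (fun j _ => Finset.sum_nonneg fun k _ => Complex.normSq_nonneg (X j k))).1 h1
    have h2 := (Finset.sum_eq_zero_iff_of_nonneg
      (fun k _ => Complex.normSq_nonneg (X j k))).1 (h3 j (Finset.mem_univ _))
    simpa using h2 k (Finset.mem_univ _)
  unfold S
  rw [md2_ones_self X hX, md2_ones_one, md2_ones_one]
  set q := ∑ j, ∑ k, Complex.normSq (X j k)
  set t := X.trace.re
  have ht : (Matrix.trace (1 : Mat (n+2))).re = (n:ℝ)+2 := by simp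
  rw [ht]
  have e1 : (0:ℝ) < (n:ℝ)+1 := by positivity
  have e2 : (0:ℝ) < (n:ℝ)+2 := by positivity
  have : 2 * (((n:ℝ)+2)⁻¹ * t)^2 - ((n:ℝ)+2)⁻¹ * ((n:ℝ)+2) * ((((n:ℝ)+1) * ((n:ℝ)+2))⁻¹ * (t^2 - q))
     = (n * t^2 + (n+2) * q) / ((n+1) * (n+2)^2) := by
    field_simp
    ring
  rw [this]
  positivity

theorem cont2 {n : ℕ} {T : Type*} [TopologicalSpace T] {A : T → Fin n → Mat (n+2)} {X Y : T → Mat (n+2)}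
    (hA : Continuous A) (hX : Continuous X) (hY : Continuous Y) :
    Continuous (fun t => mixedDisc2 (A t) (X t) (Y t)) := by
  unfold mixedDisc2
  exact cont.comp ((hA.finSnoc hX).finSnoc hY)

theorem S_smul {n : ℕ} (A : Fin n → Mat (n+2)) (B X : Mat (n+2)) (c : ℝ) :
    S A B (c • X) = c^2 * S A B X := by
  unfold S
  simp only [md2_smul, md2_smul_left]; ring

theorem deform {E : Type*} [TopologicalSpace E] {K : Set E} (hK : IsCompact K)
    (f : unitInterval × E → ℝ) (hf : Continuous f) (h0 : ∀ x ∈ K, 0 < f (0, x))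
    (h : ∀ t, (∀ x ∈ K, 0 ≤ f (t, x)) → ∀ x ∈ K, 0 < f (t, x)) : ∀ x ∈ K, 0 < f (1, x) := by
  have hcl : IsClopen {t : unitInterval | ∀ x ∈ K, 0 < f (t, x)} := by
    constructor
    · have : {t : unitInterval | ∀ x ∈ K, 0 < f (t, x)} = ⋂ x ∈ K, {t | 0 ≤ f (t, x)} := by
        ext t
        simp only [Set.mem_ofPred_eq, Set.mem_iInter]
        exact ⟨fun h x hx => (h x hx).le, h t⟩
      rw [this]
      exact isClosed_biInter fun x _ => isClosed_le continuous_const (by fun_prop)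
    · rw [isOpen_iff_mem_nhds]
      intro t ht
      exact hK.eventually_forall_of_forall_eventually fun x hx =>
        hf.continuousAt.eventually (lt_mem_nhds (ht x hx))
  have := hcl.eq_univ ⟨0, h0⟩
  have h1 : (1 : unitInterval) ∈ {t : unitInterval | ∀ x ∈ K, 0 < f (t, x)} := by
    rw [this]; exact Set.mem_univ _
  exact h1

def Inj (n : ℕ) : Prop := ∀ ω : Fin n → Mat (n+2), (∀ i, (ω i).PosDef) →
    ∀ X : Mat (n+2), X.IsHermitian →
      (∀ Y : Mat (n+2), Y.IsHermitian → mixedDisc2 ω X Y = 0) → X = 0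

theorem md2_pos {n : ℕ} (A : Fin n → Mat (n+2)) (B : Mat (n+2)) (hA : ∀ i, (A i).PosDef)
    (hB : B.PosDef) : 0 < mixedDisc2 A B B := by
  refine md_pos _ fun k => ?_
  refine Fin.lastCases ?_ (fun k => ?_) k
  · simpa
  · refine Fin.lastCases ?_ (fun k => ?_) k
    · simpa
    · simpa using hA k

theorem S_kernel {n : ℕ} (hI : Inj n) (A : Fin n → Mat (n+2)) (B X : Mat (n+2))
    (hA : ∀ i, (A i).PosDef) (hB : B.PosDef) (hX : X.IsHermitian)
    (h : ∀ Y : Mat (n+2), Y.IsHermitian → 0 ≤ S A B Y) (hS : S A B X = 0) : X = 0 := by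
  have hq := md2_pos A B hA hB
  have hb : ∀ Y : Mat (n+2), Y.IsHermitian →
      2 * mixedDisc2 A B X * mixedDisc2 A B Y = mixedDisc2 A B B * mixedDisc2 A X Y := by
    intro Y hY
    have h1 : ∀ s : ℝ, 0 ≤ S A B Y * (s * s) +
      (2 * (2 * mixedDisc2 A B X * mixedDisc2 A B Y - mixedDisc2 A B B * mixedDisc2 A X Y)) * s + 0 := by
      intro s
      have h2 := h (X + s • Y) (hX.add (by
        unfold Matrix.IsHermitian; rw [conjTranspose_smul, hY.eq]; simp))
      refine h2.trans_eq ?_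
      rw [← hS]
      unfold S
      simp only [md2_smul, md2_smul_left, md2_add, md2_add_left, md2_symm A Y X]
      ring
    have h3 := discrim_le_zero h1
    unfold discrim at h3
    nlinarith [h3]
  have h1 := hb B hB.1
  rw [md2_symm A X B] at h1
  have h2 : mixedDisc2 A B X = 0 := by
    have : mixedDisc2 A B B * mixedDisc2 A B X = 0 := by linarith
    exact (mul_eq_zero.1 this).resolve_left hq.ne'
  refine hI A hA X hX fun Y hY => ?_
  have h3 := hb Y hY
  rw [h2] at h3
  have : mixedDisc2 A B B * mixedDisc2 A X Y = 0 := by linarith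
  exact (mul_eq_zero.1 this).resolve_left hq.ne'

theorem path_posDef {m : ℕ} {B : Mat m} (hB : B.PosDef) (t : unitInterval) :
    ((1 - (t:ℝ)) • (1 : Mat m) + (t:ℝ) • B).PosDef := by
  rcases eq_or_lt_of_le t.2.1 with h | h
  · rw [← h]; simpa using Matrix.PosDef.one
  · refine Matrix.PosDef.posSemidef_add ?_ ?_
    · exact Matrix.PosSemidef.one.smul (sub_nonneg.2 t.2.2)
    · exact hB.smul h

attribute [local instance] Matrix.normedAddCommGroup Matrix.normedSpace

theorem S_pos {n : ℕ} (hI : Inj n) (A : Fin n → Mat (n+2)) (B X : Mat (n+2))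
    (hA : ∀ i, (A i).PosDef) (hB : B.PosDef) (hX : X.IsHermitian) (h0 : X ≠ 0) : 0 < S A B X := by
  let K : Set (Mat (n+2)) := {X | X.IsHermitian} ∩ Metric.sphere 0 1
  have hK : IsCompact K := by
    have : ProperSpace (Mat (n+2)) := FiniteDimensional.proper ℝ _
    refine (isCompact_sphere _ _).inter_left ?_
    exact isClosed_eq (continuous_id.matrix_conjTranspose) continuous_id
  let At : unitInterval → Fin n → Mat (n+2) := fun t k => (1 - (t:ℝ)) • (1 : Mat (n+2)) + (t:ℝ) • A k
  let Bt : unitInterval → Mat (n+2) := fun t => (1 - (t:ℝ)) • (1 : Mat (n+2)) + (t:ℝ) • B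
  have hAt : Continuous At := by fun_prop
  have hBt : Continuous Bt := by fun_prop
  have hscale : ∀ Y : Mat (n+2), Y.IsHermitian → Y ≠ 0 → ∃ c : ℝ, 0 < c ∧ ∃ Z ∈ K, Y = c • Z := by
    intro Y hY hY0
    have hn : 0 < ‖Y‖ := norm_pos_iff.2 hY0
    refine ⟨‖Y‖, hn, ‖Y‖⁻¹ • Y, ⟨?_, ?_⟩, ?_⟩
    · change (_ • Y)ᴴ = _
      rw [conjTranspose_smul, hY.eq]; simp
    · simp [norm_smul, hn.ne']
    · rw [smul_smul, mul_inv_cancel₀ hn.ne', one_smul]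
  have key := deform hK (fun p => S (At p.1) (Bt p.1) p.2) (by
      unfold S
      have a1 := hAt.comp (continuous_fst (X := unitInterval) (Y := Mat (n+2)))
      have b1 := hBt.comp (continuous_fst (X := unitInterval) (Y := Mat (n+2)))
      have c1 := continuous_snd (X := unitInterval) (Y := Mat (n+2))
      exact (continuous_const.mul ((cont2 a1 b1 c1).pow 2)).sub ((cont2 a1 b1 b1).mul (cont2 a1 c1 c1)))
    (by
      intro Y hY
      have : Y ≠ 0 := by rintro rfl; simpa using hY.2
      simpa [At, Bt] using S_ones Y hY.1 this)
    (by
      intro t ht Y hY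
      have hY0 : Y ≠ 0 := by rintro rfl; simpa using hY.2
      refine lt_of_le_of_ne (ht Y hY) fun he => hY0 ?_
      refine S_kernel hI (At t) (Bt t) Y (fun i => path_posDef (hA i) t) (path_posDef hB t) hY.1 ?_ he.symm
      intro Z hZ
      by_cases hZ0 : Z = 0
      · subst hZ0
        have := S_smul (At t) (Bt t) 0 0
        simp only [smul_zero] at this
        rw [this]; simp
      · obtain ⟨c, hc, W, hW, rfl⟩ := hscale Z hZ hZ0
        rw [S_smul]
        exact mul_nonneg (by positivity) (ht W hW))
  obtain ⟨c, hc, Z, hZ, rfl⟩ := hscale X hX h0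
  rw [S_smul]
  have := key Z hZ
  simp only [At, Bt, Set.Icc.coe_one, sub_self, zero_smul, zero_add, one_smul] at this
  positivity

theorem hodge {n : ℕ} (hI : Inj n) (A : Fin n → Mat (n+2)) (B X : Mat (n+2))
    (hA : ∀ i, (A i).PosDef) (hB : B.PosDef) (hX : X.IsHermitian) (h0 : X ≠ 0)
    (h : mixedDisc2 A B X = 0) : mixedDisc2 A X X < 0 := by
  have h1 := S_pos hI A B X hA hB hX h0
  have h2 := md2_pos A B hA hB
  unfold S at h1
  rw [h] at h1
  by_contra hc
  nlinarith [mul_nonneg h2.le (not_lt.1 hc)]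

theorem inj_zero : Inj 0 := by
  intro ω _ X hX h
  have hω : ω = fun _ => 1 := Subsingleton.elim _ _
  subst hω
  have h1 := h X hX
  have hI := h 1 Matrix.isHermitian_one
  rw [md2_symm, md2_ones_one] at hI
  rw [md2_ones_self X hX] at h1
  by_contra h0
  have := S_ones X hX h0
  unfold S at this
  rw [md2_ones_one, md2_ones_self X hX, h1, hI] at this
  simp at this

theorem inj_succ_one {n : ℕ} (hI : Inj n) (A : Fin n → Mat (n+3)) (hA : ∀ i, (A i).PosDef)
    (X : Mat (n+3)) (hX : X.IsHermitian) 
    (h : ∀ Y : Mat (n+3), Y.IsHermitian → mixedDisc2 (Fin.snoc A 1 : Fin (n+1) → Mat (n+3)) X Y = 0) :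
    X = 0 := by
  have hp : ∀ p : Fin (n+3), mixedDisc2 (fun k => del p (A k)) 1 (del p X) = 0 := by
    intro p
    have h1 := h (Matrix.single p p 1) (by
      unfold Matrix.IsHermitian; simp)
    unfold mixedDisc2 at h1
    rw [snoc_single, del_snoc2] at h1
    have h2 : del p 1 = (1 : Mat (n+2)) := 
      Matrix.submatrix_one _ Fin.succAbove_right_injective
    rw [h2] at h1
    exact (mul_eq_zero.1 h1).resolve_left (by positivity)
  have hle : ∀ p : Fin (n+3), mixedDisc2 (fun k => del p (A k)) (del p X) (del p X) ≤ 0 ∧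
     (mixedDisc2 (fun k => del p (A k)) (del p X) (del p X) = 0 → del p X = 0) := by
    intro p
    by_cases h0 : del p X = 0
    · refine ⟨?_, fun _ => h0⟩
      rw [h0]
      have := md2_smul (fun k => del p (A k)) 0 0 0
      rw [smul_zero] at this
      rw [this]; simp
    · have := hodge hI (fun k => del p (A k)) 1 (del p X) (fun i => del_posDef p (hA i))
        Matrix.PosDef.one (hX.submatrix _) h0 (hp p)
      exact ⟨this.le, fun h => absurd h this.ne⟩
  have hs := h X hX
  rw [md2_snoc_one] at hs
  have hs := (mul_eq_zero.1 hs).resolve_left (by positivity)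
  rw [Finset.sum_eq_zero_iff_of_nonpos (fun p _ => (hle p).1)] at hs
  ext i j
  obtain ⟨p, hpi, hpj⟩ : ∃ p : Fin (n+3), p ≠ i ∧ p ≠ j := by
    have : ({i, j} : Finset (Fin (n+3))).card < Fintype.card (Fin (n+3)) :=
      lt_of_le_of_lt Finset.card_le_two (by simp)
    obtain ⟨p, hp⟩ := Finset.exists_mem_notMem_of_card_lt_card (s := {i,j}) (t := Finset.univ) (by simpa using this)
    exact ⟨p, by simp at hp; tauto⟩
  obtain ⟨a, rfl⟩ := Fin.exists_succAbove_eq hpi.symm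
  obtain ⟨b, rfl⟩ := Fin.exists_succAbove_eq hpj.symm
  exact congrFun (congrFun ((hle p).2 (hs p (Finset.mem_univ _))) a) b

theorem inj_succ {n : ℕ} (hI : Inj n) : Inj (n+1) := by
  intro ω hω X hX h
  obtain ⟨C, hC, h1⟩ := exists_conj _ (hω (Fin.last n))
  have hC2 : IsUnit Cᴴ.det := by rw [det_conjTranspose]; exact hC.star
  have h2 : (fun k => C * ω k * Cᴴ) = Fin.snoc (fun k : Fin n => C * ω k.castSucc * Cᴴ) 1 := by
    ext k : 1
    refine Fin.lastCases ?_ (fun k => ?_) k <;> simp [h1]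
  have h3 := inj_succ_one hI (fun k : Fin n => C * ω k.castSucc * Cᴴ)
    (fun k => conj_posDef (hω _) hC) (C * X * Cᴴ) (isHermitian_mul_mul_conjTranspose _ hX) (by
      intro Y hY
      have : Y = C * (C⁻¹ * Y * (C⁻¹)ᴴ) * Cᴴ := by
        rw [conjTranspose_nonsing_inv, ← Matrix.mul_assoc C, Matrix.mul_assoc (C * _),
          Matrix.nonsing_inv_mul _ hC2, Matrix.mul_nonsing_inv_cancel_left _ _ hC, Matrix.mul_one]
      rw [← h2, this, conj2, h _ (isHermitian_mul_mul_conjTranspose _ hY), mul_zero])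
  have h4 : X = C⁻¹ * (C * X * Cᴴ) * (Cᴴ)⁻¹ := by
    rw [Matrix.mul_assoc C, Matrix.nonsing_inv_mul_cancel_left _ _ hC,
      Matrix.mul_nonsing_inv_cancel_right _ _ hC2]
  rw [h4, h3]; simp

theorem inj_all (n : ℕ) : Inj n := by
  induction n with
  | zero => exact inj_zero
  | succ n ih => exact inj_succ ih

end MD

theorem stmt13 {n : ℕ} (ω : Fin n → Matrix (Fin (n + 2)) (Fin (n + 2)) ℂ)
    (hω : ∀ i, (ω i).PosDef) :
    ∀ X : Matrix (Fin (n + 2)) (Fin (n + 2)) ℂ, X.IsHermitian →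
      (∀ Y : Matrix (Fin (n + 2)) (Fin (n + 2)) ℂ, Y.IsHermitian →
        mixedDisc2 ω X Y = 0) → X = 0 := by
  exact MD.inj_all n ω hω
end
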